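/- arXiv:1201.2157 — 2 statements merged into one kernel-verified Lean document; each statement's English description precedes it below -/
import Mathlib

section
/- Fix a real parameter θ > 0 and a positive integer r. There exists a constant C_r (depending only on r and θ) with the following property: for every set partition τ = (τ_1, …, τ_ℓ) of [r] into ℓ nonempty parts, every integer N ≥ 1, and all lists i = (i_1, …, i_r) and s = (s_1, …, s_r) of integers in [N], if σ is an Ewens(θ)-distributed random permutation of S_N, then |κ( ∏_{j ∈ τ_1} B^{(N)}_{i_j,s_j}, …, ∏_{j ∈ τ_ℓ} B^{(N)}_{i_j,s_j} )| ≤ C_r · N^{−c_1(i,s) − c_2(i,s,τ) + 1}, where c_1(i,s) is the number of connected components of the graph G_1(i,s), and c_2(i,s,τ) is the number of parts of the join (in the refinement lattice of set partitions of [r]) of τ with the partition of [r] into connected components of the graph G_2(i,s). -/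
open scoped BigOperators Classical
open Finset

noncomputable section

/-- Total number of cycles of a permutation of `Fin N`, fixed points included. -/
def cycleCount {N : ℕ} (σ : Equiv.Perm (Fin N)) : ℕ :=
  Multiset.card σ.cycleType + (N - σ.cycleType.sum)

/-- Expectation of `f` under the Ewens measure with parameter `θ` on `S_N`. -/
def ewensE (θ : ℝ) (N : ℕ) (f : Equiv.Perm (Fin N) → ℝ) : ℝ :=
  (∑ σ : Equiv.Perm (Fin N), θ ^ cycleCount σ * f σ) / ∏ k ∈ Finset.range N, (θ + (k : ℝ))

/-- Probability of an event under the Ewens measure. -/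
def ewensP (θ : ℝ) (N : ℕ) (A : Set (Equiv.Perm (Fin N))) : ℝ :=
  ewensE θ N (fun σ => if σ ∈ A then 1 else 0)

/-- The Bernoulli random variable `B^{(N)}_{i,s}`, equal to 1 iff `σ i = s`. -/
def Bis {N : ℕ} (i s : Fin N) (σ : Equiv.Perm (Fin N)) : ℝ :=
  if σ i = s then 1 else 0

/-- The set partitions of a finset `S`, encoded as finsets of nonempty disjoint finsets
covering `S`. -/
def partitionsOf {ι : Type*} [DecidableEq ι] (S : Finset ι) : Finset (Finset (Finset ι)) :=
  S.powerset.powerset.filter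
    (fun P => (∀ C ∈ P, C.Nonempty) ∧ ∀ j ∈ S, ∃! C, C ∈ P ∧ j ∈ C)

/-- The joint cumulant of the family of random variables indexed by `S`, expressed through
the moments function `M` : `κ = Σ_π (−1)^{#π−1} (#π−1)! Π_{C ∈ π} M C`. -/
def cumulantOn {ι 𝕜 : Type*} [DecidableEq ι] [Field 𝕜] (S : Finset ι) (M : Finset ι → 𝕜) : 𝕜 :=
  ∑ P ∈ partitionsOf S,
    (-1 : 𝕜) ^ (P.card - 1) * ((P.card - 1).factorial : 𝕜) * ∏ C ∈ P, M C

/-- The number of orbits of a permutation. -/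
def orbitCount {α : Type*} (σ : Equiv.Perm α) : ℕ :=
  Nat.card (Quotient (Equiv.Perm.SameCycle.setoid σ))

theorem cycleCount_eq_orbitCount {N : ℕ} (σ : Equiv.Perm (Fin N)) :
    cycleCount σ = orbitCount σ := by
  set f : Fin N → Equiv.Perm (Fin N) × Option (Fin N) :=
    fun x => (σ.cycleOf x, if σ x = x then some x else none) with hf
  have hfeq : ∀ x y, f x = f y ↔ σ.SameCycle x y := by
    intro x y
    simp only [hf, Prod.mk.injEq]
    constructor
    · rintro ⟨h1, h2⟩
      by_cases hx : σ x = x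
      · rw [if_pos hx] at h2
        split_ifs at h2
        simp only [Option.some.injEq] at h2
        rw [h2]
      · exact (Equiv.Perm.sameCycle_iff_cycleOf_eq_of_mem_support
          (Equiv.Perm.mem_support.2 hx) (by
            rw [if_neg hx] at h2
            split_ifs at h2 with hy
            exact Equiv.Perm.mem_support.2 hy)).2 h1
    · intro h
      refine ⟨h.cycleOf_eq, ?_⟩
      have := h.apply_eq_self_iff
      by_cases hx : σ x = x
      · have hxy : x = y := by
          have := (Equiv.Perm.SameCycle.eq_of_left h hx)
          exact this
        rw [hxy]
      · rw [if_neg hx, if_neg (fun hy => hx (this.2 hy))]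
  have h1 : orbitCount σ = (univ.image f).card := by
    rw [orbitCount, ← Set.ncard_coe_finset, coe_image, coe_univ, Set.image_univ]
    refine Nat.card_congr (Equiv.trans (Quotient.congrRight fun x y => ?_)
      (Setoid.quotientKerEquivRange f))
    exact (hfeq x y).symm
  have h2 : univ.image f = σ.cycleFactorsFinset.map ⟨fun c => (c, none), fun a b h => by simpa using h⟩
      ∪ (univ.filter fun x => σ x = x).map ⟨fun x => (1, some x), fun a b h => by simpa using h⟩ := by
    ext ⟨c, o⟩
    simp only [hf, mem_image, mem_univ, true_and, Prod.mk.injEq, mem_union, mem_map,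
      mem_filter]
    constructor
    · rintro ⟨x, rfl, rfl⟩
      by_cases hx : σ x = x
      · right
        exact ⟨x, hx, by simp [hx, (Equiv.Perm.cycleOf_eq_one_iff σ).2 hx]; rfl⟩
      · left
        exact ⟨_, Equiv.Perm.cycleOf_mem_cycleFactorsFinset_iff.2 (Equiv.Perm.mem_support.2 hx),
          by simp [hx]; rfl⟩
    · rintro (⟨c, hc, h⟩ | ⟨x, hx, h⟩) <;> obtain ⟨rfl, rfl⟩ := Prod.mk.inj h
      · obtain ⟨x, hx⟩ := (Equiv.Perm.mem_cycleFactorsFinset_iff.1 hc).1.nonempty_support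
        refine ⟨x, (Equiv.Perm.cycle_is_cycleOf hx hc).symm, ?_⟩
        rw [if_neg (Equiv.Perm.mem_support.1 (Equiv.Perm.mem_cycleFactorsFinset_support_le hc hx))]
      · exact ⟨x, (Equiv.Perm.cycleOf_eq_one_iff σ).2 hx, by rw [if_pos hx]⟩
  rw [h1, h2, card_union_of_disjoint, card_map, card_map, cycleCount, Equiv.Perm.cycleType_def]
  · have h3 := Equiv.Perm.card_fixedPoints σ
    rw [Fintype.card_fin] at h3
    simp only [Multiset.card_map, card_val]
    rw [← Equiv.Perm.cycleType_def, ← h3, Fintype.card_ofFinset]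
    congr 2
  · rw [disjoint_left]
    rintro ⟨c, o⟩ h h'
    simp only [mem_map] at h h'
    obtain ⟨_, _, h⟩ := h
    obtain ⟨_, _, h'⟩ := h'
    have := (Prod.mk.inj h).2.trans (Prod.mk.inj h').2.symm
    simp at this

theorem orbitCount_swap_mul {α : Type*} [Finite α] [DecidableEq α] (σ : Equiv.Perm α) {s s' : α}
    (h : ¬ σ.SameCycle s s') : orbitCount (Equiv.swap s s' * σ) + 1 = orbitCount σ := by
  set ρ := Equiv.swap s s' * σ with hρ
  have hss' : s ≠ s' := fun e => h (e ▸ Equiv.Perm.SameCycle.refl _ _)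
  have hρ_apply : ∀ x, ρ x = Equiv.swap s s' (σ x) := fun x => rfl
  have key : ρ.SameCycle s' s := by
    by_contra hns
    have hall : ∀ k : ℕ, ρ.SameCycle s' ((σ ^ k) s') := by
      intro k
      induction k with
      | zero => exact Equiv.Perm.SameCycle.refl _ _
      | succ k ih =>
        rw [pow_succ', Equiv.Perm.mul_apply]
        by_cases h1 : σ ((σ ^ k) s') = s'
        · rw [h1]
        · have h2 : σ ((σ ^ k) s') ≠ s := by
            intro h2
            refine h (Equiv.Perm.SameCycle.symm ⟨(k + 1 : ℕ), ?_⟩)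
            rw [zpow_natCast, pow_succ', Equiv.Perm.mul_apply, h2]
          have h3 := hρ_apply ((σ ^ k) s')
          rw [Equiv.swap_apply_of_ne_of_ne h2 h1] at h3
          rw [← h3]
          exact Equiv.Perm.sameCycle_apply_right.2 ih
    have h4 : ρ.SameCycle s' (σ⁻¹ s') := by
      rw [inv_eq_of_mul_eq_one_right (a := σ) (b := σ ^ (orderOf σ - 1))]
      · exact hall _
      · rw [← pow_succ', Nat.sub_add_cancel (orderOf_pos σ), pow_orderOf_eq_one]
    have h5 : ρ (σ⁻¹ s') = s := by rw [hρ_apply]; simp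
    exact hns (h5 ▸ Equiv.Perm.sameCycle_apply_right.2 h4)
  have hle : ∀ x y, σ.SameCycle x y → ρ.SameCycle x y := by
    have hstep : ∀ x, ρ.SameCycle x (σ x) := by
      intro x
      have h0 : ρ.SameCycle x (ρ x) := Equiv.Perm.sameCycle_apply_right.2 (.refl _ _)
      refine h0.trans ?_
      rw [hρ_apply]
      by_cases h1 : σ x = s
      · rw [h1, Equiv.swap_apply_left]; exact key
      · by_cases h2 : σ x = s'
        · rw [h2, Equiv.swap_apply_right]; exact key.symm
        · rw [Equiv.swap_apply_of_ne_of_ne h1 h2]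
    intro x y hxy
    obtain ⟨k, rfl⟩ := hxy.exists_nat_pow_eq
    induction k with
    | zero => exact .refl _ _
    | succ k ih =>
      rw [pow_succ', Equiv.Perm.mul_apply]
      exact (ih ⟨k, rfl⟩).trans (hstep _)
  let Q := Quotient (Equiv.Perm.SameCycle.setoid σ)
  let Q' := Quotient (Equiv.Perm.SameCycle.setoid ρ)
  let cl : α → Q := fun x => Quotient.mk _ x
  have hcl : ∀ x y, cl x = cl y ↔ σ.SameCycle x y := fun x y => Quotient.eq
  let g : α → Q := fun x => if cl x = cl s' then cl s else cl x
  have hg : ∀ x y, ρ.SameCycle x y → g x = g y := by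
    have hstep : ∀ x, g (ρ x) = g x := by
      intro x
      have hσx : cl (σ x) = cl x := (hcl _ _).2 (Equiv.Perm.sameCycle_apply_left.2 (.refl _ _))
      by_cases h1 : σ x = s
      · have : cl x = cl s := by rw [← hσx, h1]
        simp only [g, hρ_apply, h1, Equiv.swap_apply_left, if_true, this, ite_self]
      · by_cases h2 : σ x = s'
        · have : cl x = cl s' := by rw [← hσx, h2]
          simp only [g, hρ_apply, h2, Equiv.swap_apply_right, if_true, this, ite_self]
        · simp only [g, hρ_apply, Equiv.swap_apply_of_ne_of_ne h1 h2, hσx]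
    intro x y hxy
    obtain ⟨k, rfl⟩ := hxy.exists_nat_pow_eq
    induction k with
    | zero => rfl
    | succ k ih =>
      rw [pow_succ', Equiv.Perm.mul_apply, hstep]
      exact ih ⟨k, rfl⟩
  have hgne : ∀ x, g x ≠ cl s' := by
    intro x
    simp only [g]
    split_ifs with h1
    · exact fun h2 => h ((hcl _ _).1 h2)
    · exact h1
  have e : Q' ≃ {o : Q // o ≠ cl s'} :=
    { toFun := Quotient.lift (fun x => ⟨g x, hgne x⟩) fun x y hxy => Subtype.ext (hg x y hxy)
      invFun := fun o => Quotient.map id (fun x y hxy => hle x y hxy) o.1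
      left_inv := by
        rintro ⟨x⟩
        change Quotient.map id _ (g x) = (Quotient.mk _ x : Q')
        simp only [g]
        split_ifs with h1
        · exact Quotient.sound ((key.symm).trans (hle _ _ ((hcl _ _).1 h1).symm))
        · rfl
      right_inv := by
        rintro ⟨⟨x⟩, hx⟩
        apply Subtype.ext
        change g x = cl x
        exact if_neg hx }
  have h1 : Nat.card Q' = Nat.card {o : Q // o ≠ cl s'} := Nat.card_congr e
  have : Finite Q := inferInstanceAs (Finite (Quotient _))
  have h2 : Nat.card {o : Q // o ≠ cl s'} + 1 = Nat.card Q := by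
    have := Fintype.ofFinite Q
    rw [Nat.card_eq_fintype_card, Nat.card_eq_fintype_card, Fintype.card_subtype_compl,
      Fintype.card_subtype_eq]
    exact Nat.sub_add_cancel (Fintype.card_pos_iff.2 ⟨cl s'⟩)
  rw [orbitCount, orbitCount]
  change Nat.card Q' + 1 = Nat.card Q
  rw [h1, h2]

/-- Total Ewens weight of the permutations whose graph contains `p`. -/
def ewensZ {N : ℕ} (θ : ℝ) (p : Finset (Fin N × Fin N)) : ℝ :=
  ∑ σ : Equiv.Perm (Fin N) with ∀ e ∈ p, σ e.1 = e.2, θ ^ cycleCount σ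

/-- Adding the edge `e` to the graph `p` closes a cycle. -/
def ClosesCycle {α : Type*} (p : Finset (α × α)) (e : α × α) : Prop :=
  Relation.ReflTransGen (fun a b => (a, b) ∈ p) e.2 e.1

/-- Multiplicative change of the normalized weight when the edge `e` is added to `p`. -/
def edgeFactor {α : Type*} (θ : ℝ) (p : Finset (α × α)) (e : α × α) : ℝ :=
  if ∃ x ∈ p, x.1 = e.1 ∨ x.2 = e.2 then 0 else if ClosesCycle p e then θ else 1

theorem ewensZ_closing {N : ℕ} (θ : ℝ) (p : Finset (Fin N × Fin N)) {i s s' : Fin N}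
    (hs : ∀ x ∈ p, x.2 ≠ s) (hs' : ∀ x ∈ p, x.2 ≠ s') (hne : s' ≠ s)
    (hcl : ClosesCycle p (i, s)) :
    ewensZ θ (insert (i, s) p) = θ * ewensZ θ (insert (i, s') p) := by
  rw [ewensZ, ewensZ, mul_sum]
  have hmaps : ∀ (a b : Fin N) (σ : Equiv.Perm (Fin N)), (∀ x ∈ p, x.2 ≠ a) → (∀ x ∈ p, x.2 ≠ b) →
      (∀ e ∈ insert (i, a) p, σ e.1 = e.2) →
      ∀ e ∈ insert (i, b) p, (Equiv.swap a b * σ) e.1 = e.2 := by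
    intro a b σ ha hb h e he
    rw [Equiv.Perm.mul_apply]
    rcases mem_insert.1 he with rfl | he
    · rw [h (i, a) (mem_insert_self _ _), Equiv.swap_apply_left]
    · rw [h e (mem_insert_of_mem he), Equiv.swap_apply_of_ne_of_ne (ha e he) (hb e he)]
  refine sum_bij' (fun σ _ => Equiv.swap s s' * σ) (fun σ _ => Equiv.swap s' s * σ) ?_ ?_ ?_ ?_ ?_
  · intro σ hσ
    rw [mem_filter] at hσ ⊢
    exact ⟨mem_univ _, hmaps s s' σ hs hs' hσ.2⟩
  · intro σ hσ
    rw [mem_filter] at hσ ⊢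
    exact ⟨mem_univ _, hmaps s' s σ hs' hs hσ.2⟩
  · intro σ _
    rw [← mul_assoc, Equiv.swap_comm s' s, Equiv.swap_mul_self, one_mul]
  · intro σ _
    rw [← mul_assoc, Equiv.swap_comm s' s, Equiv.swap_mul_self, one_mul]
  · intro σ hσ
    rw [mem_filter] at hσ
    have hσ := hσ.2
    have hsc : ¬ σ.SameCycle s s' := by
      intro hsc
      have hstep : ∀ k : ℕ, Relation.ReflTransGen (fun a b => (a, b) ∈ p) s ((σ ^ k) s) ∧
          Relation.ReflTransGen (fun a b => (a, b) ∈ p) ((σ ^ k) s) i := by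
        intro k
        induction k with
        | zero => exact ⟨.refl, hcl⟩
        | succ k ih =>
          rw [pow_succ', Equiv.Perm.mul_apply]
          rcases ih.2.cases_head with h | ⟨y, hy, hyi⟩
          · rw [h, hσ (i, s) (mem_insert_self _ _)]
            exact ⟨.refl, hcl⟩
          · rw [hσ (_, y) (mem_insert_of_mem hy)]
            exact ⟨ih.1.tail hy, hyi⟩
      obtain ⟨k, hk⟩ := hsc.exists_nat_pow_eq
      have h1 := (hstep k).1
      rw [hk] at h1
      rcases h1.cases_tail with h | ⟨y, -, hy⟩
      · exact hne h
      · exact hs' _ hy rfl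
    rw [cycleCount_eq_orbitCount, cycleCount_eq_orbitCount, ← orbitCount_swap_mul σ hsc, pow_succ']

theorem exists_closesCycle {N : ℕ} (p : Finset (Fin N × Fin N)) (σ : Equiv.Perm (Fin N))
    (hσ : ∀ e ∈ p, σ e.1 = e.2) {i : Fin N} (hi : ∀ x ∈ p, x.1 ≠ i) :
    ∃ s, (∀ x ∈ p, x.2 ≠ s) ∧ ClosesCycle p (i, s) := by
  by_contra! hcon
  let R : Finset (Fin N) := univ.filter fun x => ClosesCycle p (i, x)
  have hpre : ∀ x ∈ R, (σ⁻¹ x, x) ∈ p := by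
    intro x hx
    by_contra hx'
    refine hcon x (fun y hy hyx => hx' ?_) (mem_filter.1 hx).2
    rwa [← hyx, Equiv.Perm.inv_eq_iff_eq.2 (hσ y hy).symm]
  have hmaps : ∀ x ∈ R, σ⁻¹ x ∈ R := by
    intro x hx
    rw [mem_filter]
    exact ⟨mem_univ _, (mem_filter.1 hx).2.head (hpre x hx)⟩
  have himg : R.image (fun x => σ⁻¹ x) = R := by
    refine eq_of_subset_of_card_le (fun y hy => ?_) ?_
    · obtain ⟨x, hx, rfl⟩ := mem_image.1 hy
      exact hmaps x hx
    · rw [card_image_of_injective _ (Equiv.injective _)]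
  have hiR : i ∈ R := mem_filter.2 ⟨mem_univ _, .refl⟩
  rw [← himg] at hiR
  obtain ⟨x, hx, hxi⟩ := mem_image.1 hiR
  exact hi _ (hpre x hx) hxi

theorem ewensZ_eq_sum_insert {N : ℕ} (θ : ℝ) (p : Finset (Fin N × Fin N)) (i : Fin N) :
    ewensZ θ p = ∑ s, ewensZ θ (insert (i, s) p) := by
  rw [ewensZ, ← sum_fiberwise (s := univ.filter fun σ : Equiv.Perm (Fin N) => ∀ e ∈ p, σ e.1 = e.2)
    (g := fun σ => σ i)]
  refine sum_congr rfl fun s _ => ?_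
  rw [ewensZ, filter_filter]
  refine sum_congr (filter_congr fun σ _ => ?_) fun _ _ => rfl
  rw [forall_mem_insert, and_comm]

theorem ewensZ_insert {N : ℕ} {θ : ℝ} (hθ : 0 < θ) (p : Finset (Fin N × Fin N)) {e : Fin N × Fin N}
    (he : e ∉ p) :
    ewensZ θ (insert e p) * (θ + N - 1 - p.card) = edgeFactor θ p e * ewensZ θ p := by
  obtain ⟨i, s⟩ := e
  have hzero : ∀ e : Fin N × Fin N, e ∉ p → (∃ x ∈ p, x.1 = e.1 ∨ x.2 = e.2) →
      ewensZ θ (insert e p) = 0 := by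
    rintro e he ⟨x, hx, h⟩
    rw [ewensZ]
    refine sum_eq_zero fun σ hσ => absurd ?_ he
    have hσ := (mem_filter.1 hσ).2
    have h1 := hσ e (mem_insert_self _ _)
    have h2 := hσ x (mem_insert_of_mem hx)
    have : x = e := by
      rcases h with h | h
      · exact Prod.ext h (by rw [← h1, ← h2, h])
      · exact Prod.ext (σ.injective (by rw [h1, h2, h])) h
    exact this ▸ hx
  rw [edgeFactor]
  split_ifs with hex hcl
  · rw [hzero _ he hex, zero_mul, zero_mul]
  all_goals
    push Not at hex
    have hi : ∀ x ∈ p, x.1 ≠ i := fun x hx => (hex x hx).1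
    have hs : ∀ x ∈ p, x.2 ≠ s := fun x hx => (hex x hx).2
    by_cases hne : ∃ σ : Equiv.Perm (Fin N), ∀ e ∈ p, σ e.1 = e.2
    swap
    · have h0 : ∀ q, p ⊆ q → ewensZ θ q = 0 := by
        intro q hq
        rw [ewensZ]
        refine sum_eq_zero fun σ hσ => absurd ⟨σ, fun e he => (mem_filter.1 hσ).2 e (hq he)⟩ hne
      rw [h0 _ (subset_insert _ _), h0 p Subset.rfl, zero_mul, mul_zero]
    obtain ⟨σ, hσ⟩ := hne
    have hclosing : ∀ s, (∀ x ∈ p, x.2 ≠ s) → ClosesCycle p (i, s) →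
        ewensZ θ (insert (i, s) p) * (θ + N - 1 - p.card) = θ * ewensZ θ p := by
      intro s hs hcl
      have hmem : s ∈ univ \ p.image Prod.snd := by
        simp only [mem_sdiff, mem_univ, true_and, mem_image, not_exists, not_and]
        exact hs
      have hcard : (univ \ p.image Prod.snd).card + p.card = N := by
        rw [← card_image_of_injOn (f := Prod.snd) (s := p), card_sdiff_add_card_eq_card (subset_univ _),
          card_univ, Fintype.card_fin]
        intro x hx y hy hxy
        exact Prod.ext (σ.injective (by rw [hσ x hx, hσ y hy]; exact hxy)) hxy
      rw [ewensZ_eq_sum_insert θ p i, ← sum_sdiff (subset_univ (p.image Prod.snd)),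
        sum_eq_zero (s := p.image Prod.snd), add_zero, ← add_sum_erase _ _ hmem, mul_add, mul_sum,
        sum_congr (g := fun _ => ewensZ θ (insert (i, s) p)) rfl, sum_const, card_erase_of_mem hmem,
        nsmul_eq_mul, Nat.cast_sub (card_pos.2 ⟨s, hmem⟩)]
      · have : ((univ \ p.image Prod.snd).card : ℝ) + p.card = N := by exact_mod_cast hcard
        rw [← this]
        push_cast
        ring
      · intro s' hs'
        rw [mem_erase, mem_sdiff] at hs'
        refine (ewensZ_closing θ p hs (fun x hx h => hs'.2.2 ?_) hs'.1 hcl).symm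
        exact mem_image.2 ⟨x, hx, h⟩
      · intro s' hs'
        obtain ⟨x, hx, rfl⟩ := mem_image.1 hs'
        exact hzero _ (fun h => hi _ h rfl) ⟨x, hx, Or.inr rfl⟩
  · exact hclosing s hs hcl
  · obtain ⟨s₀, hs₀, hcl₀⟩ := exists_closesCycle p σ hσ hi
    have h1 := hclosing s₀ hs₀ hcl₀
    have hne : s ≠ s₀ := by rintro rfl; exact hcl hcl₀
    rw [ewensZ_closing θ p hs₀ hs hne hcl₀, mul_assoc] at h1
    rw [one_mul]
    exact mul_left_cancel₀ hθ.ne' h1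

/-- The falling factorial `(θ + N - 1)(θ + N - 2) ⋯ (θ + N - k)`. -/
def ewensFalling (θ : ℝ) (N k : ℕ) : ℝ := ∏ j ∈ range k, (θ + N - 1 - j)

/-- The probability that the graph of an Ewens permutation contains `p`, renormalized by
the falling factorial of length `p.card`. -/
def ewensWeight {N : ℕ} (θ : ℝ) (p : Finset (Fin N × Fin N)) : ℝ :=
  ewensZ θ p * ewensFalling θ N p.card / ewensZ θ (∅ : Finset (Fin N × Fin N))

theorem ewensFalling_pos {θ : ℝ} (hθ : 0 < θ) {N k : ℕ} (hk : k ≤ N) : 0 < ewensFalling θ N k := by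
  refine prod_pos fun j hj => ?_
  have : j + 1 ≤ N := (mem_range.1 hj).trans_le hk
  have : (j : ℝ) + 1 ≤ N := by exact_mod_cast this
  linarith

theorem ewensZ_diagonal {N : ℕ} {θ : ℝ} (hθ : 0 < θ) (s : Finset (Fin N)) :
    ewensZ θ (s.image fun j => (j, j)) * ewensFalling θ N s.card =
      θ ^ s.card * ewensZ θ (∅ : Finset (Fin N × Fin N)) := by
  induction s using Finset.induction_on with
  | empty => simp [ewensFalling]
  | insert a s ha ih =>
    have hmem : (a, a) ∉ s.image fun j => (j, j) := by simpa using ha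
    have h := ewensZ_insert hθ _ hmem
    rw [edgeFactor, if_neg, if_pos (show ClosesCycle _ (a, a) from .refl),
      card_image_of_injective _ fun x y h => (Prod.mk.inj h).1] at h
    · rw [image_insert, card_insert_of_notMem ha, ewensFalling, prod_range_succ, ← ewensFalling,
        mul_comm (ewensFalling _ _ _), ← mul_assoc, h, mul_assoc, ih, pow_succ']
      ring
    · rintro ⟨x, hx, hxa⟩
      obtain ⟨j, hj, rfl⟩ := mem_image.1 hx
      have : j = a := by simpa using hxa
      exact ha (this ▸ hj)

theorem ewensZ_empty (θ : ℝ) (hθ : 0 < θ) (N : ℕ) :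
    ewensZ θ (∅ : Finset (Fin N × Fin N)) = ∏ k ∈ range N, (θ + (k : ℝ)) := by
  have h := ewensZ_diagonal hθ (univ : Finset (Fin N))
  have h1 : ewensZ θ ((univ : Finset (Fin N)).image fun j => (j, j)) = θ ^ N := by
    rw [ewensZ, show (univ.filter fun σ : Equiv.Perm (Fin N) =>
      ∀ e ∈ (univ : Finset (Fin N)).image fun j => (j, j), σ e.1 = e.2) = {1} from ?_, sum_singleton]
    · simp [cycleCount]
    · ext σ
      simp [Equiv.ext_iff]
  rw [h1, card_univ, Fintype.card_fin] at h
  rw [← mul_left_cancel₀ (pow_ne_zero _ hθ.ne') h, ewensFalling, ← prod_range_reflect]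
  refine prod_congr rfl fun j hj => ?_
  have : j + 1 ≤ N := mem_range.1 hj
  rw [Nat.sub_sub, Nat.cast_sub (by omega)]
  push_cast
  ring

theorem ewensZ_empty_pos {θ : ℝ} (hθ : 0 < θ) (N : ℕ) :
    0 < ewensZ θ (∅ : Finset (Fin N × Fin N)) := by
  rw [ewensZ_empty θ hθ]
  exact prod_pos fun k _ => by positivity

theorem ewensWeight_empty {θ : ℝ} (hθ : 0 < θ) (N : ℕ) :
    ewensWeight θ (∅ : Finset (Fin N × Fin N)) = 1 := by
  rw [ewensWeight, card_empty, ewensFalling, prod_range_zero, mul_one,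
    div_self (ewensZ_empty_pos hθ N).ne']

theorem ewensWeight_insert {N : ℕ} {θ : ℝ} (hθ : 0 < θ) {p : Finset (Fin N × Fin N)}
    {e : Fin N × Fin N} (he : e ∉ p) :
    ewensWeight θ (insert e p) = edgeFactor θ p e * ewensWeight θ p := by
  rw [ewensWeight, ewensWeight, card_insert_of_notMem he, ewensFalling, prod_range_succ,
    ← ewensFalling, mul_comm (ewensFalling _ _ _), ← mul_assoc, ewensZ_insert hθ p he]
  ring

theorem abs_ewensWeight_le {N : ℕ} {θ : ℝ} (hθ : 0 < θ) (p : Finset (Fin N × Fin N)) :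
    |ewensWeight θ p| ≤ (1 + θ) ^ p.card := by
  induction p using Finset.induction_on with
  | empty => simp [ewensWeight_empty hθ]
  | insert e p he ih =>
    rw [ewensWeight_insert hθ he, abs_mul, card_insert_of_notMem he, pow_succ']
    refine mul_le_mul ?_ ih (abs_nonneg _) (by linarith)
    rw [edgeFactor]
    split_ifs
    · rw [abs_zero]; linarith
    · rw [abs_of_pos hθ]; linarith
    · rw [abs_one]; linarith

/-- Two edges without common endpoint. -/
def EdgeDisjoint {α : Type*} (x y : α × α) : Prop :=
  x.1 ≠ y.1 ∧ x.1 ≠ y.2 ∧ x.2 ≠ y.1 ∧ x.2 ≠ y.2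

theorem closesCycle_union_iff {α : Type*} [DecidableEq α] {p q : Finset (α × α)} {e : α × α}
    (hpq : ∀ x ∈ p, ∀ y ∈ q, EdgeDisjoint x y) (he : ∀ y ∈ q, EdgeDisjoint e y) :
    ClosesCycle (p ∪ q) e ↔ ClosesCycle p e := by
  refine ⟨fun h => ?_, Relation.ReflTransGen.mono (fun a b hab => mem_union_left _ hab) _ _⟩
  suffices ∀ a, Relation.ReflTransGen (fun a b => (a, b) ∈ p ∪ q) e.2 a →
      (∀ y ∈ q, a ≠ y.1) ∧ Relation.ReflTransGen (fun a b => (a, b) ∈ p) e.2 a from (this _ h).2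
  intro a ha
  induction ha with
  | refl => exact ⟨fun y hy => (he y hy).2.2.1, .refl⟩
  | tail _ hbc ih =>
    rcases mem_union.1 hbc with h | h
    · exact ⟨fun y hy => (hpq _ h y hy).2.2.1, ih.2.tail h⟩
    · exact absurd rfl (ih.1 _ h)

theorem ewensWeight_union {N : ℕ} {θ : ℝ} (hθ : 0 < θ) (p q : Finset (Fin N × Fin N))
    (hpq : ∀ x ∈ p, ∀ y ∈ q, EdgeDisjoint x y) :
    ewensWeight θ (p ∪ q) = ewensWeight θ p * ewensWeight θ q := by
  induction p using Finset.induction_on with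
  | empty => simp [ewensWeight_empty hθ]
  | insert e p he ih =>
    have hpq' : ∀ x ∈ p, ∀ y ∈ q, EdgeDisjoint x y := fun x hx => hpq x (mem_insert_of_mem hx)
    have heq : ∀ y ∈ q, EdgeDisjoint e y := hpq e (mem_insert_self _ _)
    have he' : e ∉ p ∪ q := by
      rw [mem_union, not_or]
      exact ⟨he, fun h => (heq e h).1 rfl⟩
    rw [insert_union, ewensWeight_insert hθ he', ewensWeight_insert hθ he, ih hpq', mul_assoc]
    congr 1
    have hex : (∃ x ∈ p ∪ q, x.1 = e.1 ∨ x.2 = e.2) ↔ ∃ x ∈ p, x.1 = e.1 ∨ x.2 = e.2 := by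
      refine ⟨?_, fun ⟨x, hx, h⟩ => ⟨x, mem_union_left _ hx, h⟩⟩
      rintro ⟨x, hx, h⟩
      rcases mem_union.1 hx with hx | hx
      · exact ⟨x, hx, h⟩
      · rcases h with h | h
        · exact absurd h.symm (heq x hx).1
        · exact absurd h.symm (heq x hx).2.2.2
    simp only [edgeFactor, hex, closesCycle_union_iff hpq' heq]
    congr

theorem ewensE_contains {θ : ℝ} (hθ : 0 < θ) {N : ℕ} (p : Finset (Fin N × Fin N)) :
    ewensE θ N (fun σ => if ∀ e ∈ p, σ e.1 = e.2 then 1 else 0) =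
      ewensZ θ p / ewensZ θ (∅ : Finset (Fin N × Fin N)) := by
  rw [ewensE, ewensZ_empty θ hθ, ewensZ, sum_filter]
  simp only [mul_ite, mul_one, mul_zero]

theorem ewensE_contains_eq_weight {θ : ℝ} (hθ : 0 < θ) {N : ℕ} {p : Finset (Fin N × Fin N)}
    (hp : p.card ≤ N) :
    ewensE θ N (fun σ => if ∀ e ∈ p, σ e.1 = e.2 then 1 else 0) =
      ewensWeight θ p / ewensFalling θ N p.card := by
  have := (ewensFalling_pos hθ hp).ne'
  rw [ewensE_contains hθ, ewensWeight]
  field_simp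

theorem abs_ewensE_contains_le_one {θ : ℝ} (hθ : 0 < θ) {N : ℕ} (p : Finset (Fin N × Fin N)) :
    |ewensE θ N (fun σ => if ∀ e ∈ p, σ e.1 = e.2 then 1 else 0)| ≤ 1 := by
  have h0 : ∀ σ : Equiv.Perm (Fin N), 0 ≤ θ ^ cycleCount σ := fun σ => by positivity
  have h1 : 0 ≤ ewensZ θ p := sum_nonneg fun σ _ => h0 σ
  rw [ewensE_contains hθ, abs_of_nonneg (div_nonneg h1 (ewensZ_empty_pos hθ N).le),
    div_le_one (ewensZ_empty_pos hθ N)]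
  refine sum_le_sum_of_subset_of_nonneg (fun σ _ => ?_) fun σ _ _ => h0 σ
  simp

section Cumulants

variable {ι : Type*} [DecidableEq ι]

theorem mem_partitionsOf {S : Finset ι} {P : Finset (Finset ι)} :
    P ∈ partitionsOf S ↔ (∀ C ∈ P, C ⊆ S) ∧ (∀ C ∈ P, C.Nonempty) ∧
      ∀ j ∈ S, ∃! C, C ∈ P ∧ j ∈ C := by
  rw [partitionsOf, mem_filter, mem_powerset]
  refine and_congr_left fun _ => ?_
  exact ⟨fun h C hC => mem_powerset.1 (h hC), fun h C hC => mem_powerset.2 (h C hC)⟩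

theorem disjoint_of_mem_partitionsOf {S : Finset ι} {P : Finset (Finset ι)}
    (hP : P ∈ partitionsOf S) {C D : Finset ι} (hC : C ∈ P) (hD : D ∈ P) (h : C ≠ D) :
    Disjoint C D := by
  rw [mem_partitionsOf] at hP
  rw [disjoint_left]
  intro j hj hj'
  exact h ((hP.2.2 j (hP.1 C hC hj)).unique ⟨hC, hj⟩ ⟨hD, hj'⟩)

theorem erase_mem_partitionsOf {S : Finset ι} {P : Finset (Finset ι)} (hP : P ∈ partitionsOf S)
    {D : Finset ι} (hD : D ∈ P) : P.erase D ∈ partitionsOf (S \ D) := by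
  have hdis := fun C (hC : C ∈ P) (h : C ≠ D) => disjoint_of_mem_partitionsOf hP hC hD h
  rw [mem_partitionsOf] at hP ⊢
  refine ⟨fun C hC => subset_sdiff.2 ⟨hP.1 C (mem_of_mem_erase hC), hdis C (mem_of_mem_erase hC)
    (ne_of_mem_erase hC)⟩, fun C hC => hP.2.1 C (mem_of_mem_erase hC), fun j hj => ?_⟩
  rw [mem_sdiff] at hj
  obtain ⟨C, hC, huniq⟩ := hP.2.2 j hj.1
  refine ⟨C, ⟨mem_erase.2 ⟨?_, hC.1⟩, hC.2⟩, fun C' hC' => huniq C' ⟨mem_of_mem_erase hC'.1, hC'.2⟩⟩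
  rintro rfl
  exact hj.2 hC.2

theorem insert_mem_partitionsOf {S C : Finset ι} {P : Finset (Finset ι)} (hP : P ∈ partitionsOf C)
    (hCS : C ⊆ S) (hne : (S \ C).Nonempty) : insert (S \ C) P ∈ partitionsOf S := by
  rw [mem_partitionsOf] at hP ⊢
  refine ⟨?_, ?_, ?_⟩
  · rw [forall_mem_insert]
    exact ⟨sdiff_subset, fun D hD => (hP.1 D hD).trans hCS⟩
  · rw [forall_mem_insert]
    exact ⟨hne, hP.2.1⟩
  · intro j hj
    by_cases hjC : j ∈ C
    · obtain ⟨D, hD, huniq⟩ := hP.2.2 j hjC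
      refine ⟨D, ⟨mem_insert_of_mem hD.1, hD.2⟩, fun D' hD' => ?_⟩
      rcases mem_insert.1 hD'.1 with rfl | h
      · exact absurd hjC (mem_sdiff.1 hD'.2).2
      · exact huniq D' ⟨h, hD'.2⟩
    · refine ⟨S \ C, ⟨mem_insert_self _ _, mem_sdiff.2 ⟨hj, hjC⟩⟩, fun D' hD' => ?_⟩
      rcases mem_insert.1 hD'.1 with rfl | h
      · rfl
      · exact absurd (hP.1 D' h hD'.2) hjC

theorem notMem_partitionsOf_sdiff {S C : Finset ι} {P : Finset (Finset ι)}
    (hP : P ∈ partitionsOf C) (hne : (S \ C).Nonempty) : S \ C ∉ P := by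
  intro h
  obtain ⟨j, hj⟩ := hne
  exact (mem_sdiff.1 hj).2 ((mem_partitionsOf.1 hP).1 _ h hj)

theorem singleton_mem_partitionsOf {S : Finset ι} (hS : S.Nonempty) : {S} ∈ partitionsOf S := by
  rw [mem_partitionsOf]
  refine ⟨by simp, by simpa using hS, fun j hj => ⟨S, by simpa using hj, by simp⟩⟩

theorem eq_singleton_of_card_partitionsOf {S : Finset ι} (hS : S.Nonempty) {P : Finset (Finset ι)}
    (hP : P ∈ partitionsOf S) (hcard : P.card ≤ 1) : P = {S} := by
  rw [mem_partitionsOf] at hP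
  obtain ⟨j, hj⟩ := hS
  obtain ⟨C, hC, -⟩ := hP.2.2 j hj
  have h1 : P = {C} := (eq_of_subset_of_card_le (singleton_subset_iff.2 hC.1) (by simpa)).symm
  rw [h1]
  congr 1
  refine (hP.1 C hC.1).antisymm fun k hk => ?_
  obtain ⟨D, hD, -⟩ := hP.2.2 k hk
  rw [h1, mem_singleton] at hD
  exact hD.1 ▸ hD.2

/-- The block not containing `s` can be split off a partition: moments in terms of cumulants. -/
theorem moment_eq_sum_cumulantOn {M : Finset ι → ℝ} (hM : M ∅ = 1) {S : Finset ι} {s : ι}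
    (hs : s ∈ S) :
    M S = ∑ C ∈ S.powerset with s ∈ C, cumulantOn C M * M (S \ C) := by
  have hSmem : S ∈ S.powerset.filter fun C => s ∈ C := by simpa using hs
  rw [← add_sum_erase _ _ hSmem, Finset.sdiff_self, hM, mul_one]
  have h1 : ∑ C ∈ (S.powerset.filter fun C => s ∈ C).erase S, cumulantOn C M * M (S \ C) =
      ∑ Q ∈ partitionsOf S, ∑ _D ∈ Q.filter fun D => s ∉ D,
        (-1 : ℝ) ^ (Q.card - 2) * ((Q.card - 2).factorial : ℝ) * ∏ C ∈ Q, M C := by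
    simp only [cumulantOn, sum_mul]
    rw [sum_sigma', sum_sigma']
    refine sum_bij' (fun x _ => ⟨insert (S \ x.1) x.2, S \ x.1⟩) (fun x _ => ⟨S \ x.2, x.1.erase x.2⟩)
      ?_ ?_ ?_ ?_ ?_
    all_goals
      rintro ⟨A, B⟩ hAB
      simp only [mem_sigma, mem_erase, mem_filter, mem_powerset] at hAB
    · obtain ⟨⟨hne, hAS, hsA⟩, hB⟩ := hAB
      have hne' : (S \ A).Nonempty := sdiff_nonempty.2 fun h => hne (hAS.antisymm h)
      simp only [mem_sigma, mem_filter, mem_insert_self, true_and, mem_sdiff, not_and, not_not]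
      exact ⟨insert_mem_partitionsOf hB hAS hne', fun _ => hsA⟩
    · obtain ⟨hA, hB, hsB⟩ := hAB
      have hA' := mem_partitionsOf.1 hA
      simp only [mem_sigma, mem_erase, mem_filter, mem_powerset, mem_sdiff]
      refine ⟨⟨fun h => ?_, sdiff_subset, hs, hsB⟩, erase_mem_partitionsOf hA hB⟩
      obtain ⟨j, hj⟩ := hA'.2.1 B hB
      have hjS := hA'.1 B hB hj
      rw [← h] at hjS
      exact (mem_sdiff.1 hjS).2 hj
    · obtain ⟨⟨hne, hAS, hsA⟩, hB⟩ := hAB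
      have hne' : (S \ A).Nonempty := sdiff_nonempty.2 fun h => hne (hAS.antisymm h)
      simp only [Finset.sdiff_sdiff_eq_self hAS, erase_insert (notMem_partitionsOf_sdiff hB hne')]
    · obtain ⟨hA, hB, hsB⟩ := hAB
      have hBS := (mem_partitionsOf.1 hA).1 B hB
      simp only [Finset.sdiff_sdiff_eq_self hBS, insert_erase hB]
    · obtain ⟨⟨hne, hAS, hsA⟩, hB⟩ := hAB
      have hne' : (S \ A).Nonempty := sdiff_nonempty.2 fun h => hne (hAS.antisymm h)
      have := notMem_partitionsOf_sdiff hB hne'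
      rw [card_insert_of_notMem this, prod_insert this]
      simp only [Nat.reduceSubDiff]
      ring
  rw [h1, cumulantOn, ← sum_add_distrib, sum_eq_single {S}]
  · simp [hs]
  · intro Q hQ hne
    have hcard : 2 ≤ Q.card := by
      by_contra! h
      exact hne (eq_singleton_of_card_partitionsOf ⟨s, hs⟩ hQ (by omega))
    have hQ' := mem_partitionsOf.1 hQ
    obtain ⟨C, hC, huniq⟩ := hQ'.2.2 s hs
    have hfil : (Q.filter fun D => s ∉ D) = Q.erase C := by
      ext D
      rw [mem_filter, mem_erase]
      constructor
      · rintro ⟨h1, h2⟩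
        exact ⟨fun h => h2 (h ▸ hC.2), h1⟩
      · rintro ⟨h1, h2⟩
        exact ⟨h2, fun h => h1 (huniq D ⟨h2, h⟩)⟩
    rw [hfil, sum_const, card_erase_of_mem hC.1, nsmul_eq_mul]
    obtain ⟨k, hk⟩ := Nat.exists_eq_add_of_le hcard
    rw [hk, show 2 + k - 1 = k + 1 by omega, show 2 + k - 2 = k by omega, Nat.factorial_succ, pow_succ]
    push_cast
    ring
  · exact fun h => absurd (singleton_mem_partitionsOf ⟨s, hs⟩) h

theorem cumulantOn_eq_zero {M : Finset ι → ℝ} (hM : M ∅ = 1) (U : Finset ι)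
    (hU : ∀ Δ, M Δ = M (Δ ∩ U) * M (Δ \ U)) (S : Finset ι) (h1 : (S ∩ U).Nonempty)
    (h2 : (S \ U).Nonempty) : cumulantOn S M = 0 := by
  induction S using Finset.strongInduction with
  | H S ih =>
    obtain ⟨s, hs⟩ := h1
    have hsS := mem_of_mem_inter_left hs
    have hrec := moment_eq_sum_cumulantOn hM hsS
    have hSmem : S ∈ S.powerset.filter fun C => s ∈ C := by simpa using hsS
    rw [← add_sum_erase _ _ hSmem, Finset.sdiff_self, hM, mul_one] at hrec
    have hsub : ((S ∩ U).powerset.filter fun C => s ∈ C) ⊆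
        (S.powerset.filter fun C => s ∈ C).erase S := by
      intro C hC
      rw [mem_filter, mem_powerset] at hC
      rw [mem_erase, mem_filter, mem_powerset]
      refine ⟨?_, hC.1.trans inter_subset_left, hC.2⟩
      rintro rfl
      obtain ⟨j, hj⟩ := h2
      rw [mem_sdiff] at hj
      exact hj.2 (mem_of_mem_inter_right (hC.1 hj.1))
    rw [← sum_subset hsub] at hrec
    · have h3 : ∑ C ∈ (S ∩ U).powerset with s ∈ C, cumulantOn C M * M (S \ C) =
          M (S ∩ U) * M (S \ U) := by
        rw [moment_eq_sum_cumulantOn hM hs, sum_mul]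
        refine sum_congr rfl fun C hC => ?_
        rw [mem_filter, mem_powerset] at hC
        have hCU : C ⊆ U := hC.1.trans inter_subset_right
        have e1 : (S \ C) ∩ U = (S ∩ U) \ C := by ext; simp; tauto
        have e2 : (S \ C) \ U = S \ U := by
          ext j
          have := @hCU j
          simp only [mem_sdiff]
          tauto
        rw [hU (S \ C), mul_assoc, e1, e2]
      rw [h3, ← hU] at hrec
      linarith
    · intro C hC hC'
      rw [mem_erase, mem_filter, mem_powerset] at hC
      rw [mem_filter, mem_powerset, not_and'] at hC'
      rw [ih C (hC.2.1.ssubset_of_ne hC.1) ⟨s, mem_inter.2 ⟨hC.2.2, mem_of_mem_inter_right hs⟩⟩,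
        zero_mul]
      rw [sdiff_nonempty]
      exact fun h => hC' hC.2.2 (subset_inter hC.2.1 h)

end Cumulants

section MixedDifferences

variable {K : Type*} [DecidableEq K]

/-- Mixed difference (Möbius transform) of a function of finite sets. -/
def mixedDiff (f : Finset K → ℝ) (A : Finset K) : ℝ :=
  ∑ B ∈ A.powerset, (-1) ^ (A \ B).card * f B

theorem mixedDiff_empty (f : Finset K → ℝ) : mixedDiff f ∅ = f ∅ := by
  simp [mixedDiff]

theorem mixedDiff_congr {f g : Finset K → ℝ} {A : Finset K} (h : ∀ B ⊆ A, f B = g B) :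
    mixedDiff f A = mixedDiff g A :=
  sum_congr rfl fun B hB => by rw [h B (mem_powerset.1 hB)]

theorem mixedDiff_insert (f : Finset K → ℝ) {A : Finset K} {m : K} (hm : m ∉ A) :
    mixedDiff f (insert m A) = mixedDiff (fun B => f (insert m B) - f B) A := by
  rw [mixedDiff, sum_powerset_insert hm, mixedDiff, ← sum_add_distrib]
  refine sum_congr rfl fun B hB => ?_
  have hBA := mem_powerset.1 hB
  have hmB : m ∉ B := fun h => hm (hBA h)
  rw [insert_sdiff_of_notMem _ hmB, card_insert_of_notMem (fun h => hm (mem_sdiff.1 h).1),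
    insert_sdiff_insert, sdiff_insert_of_notMem hm, pow_succ]
  ring

theorem mixedDiff_sum {β : Type*} (s : Finset β) (f : β → Finset K → ℝ) (A : Finset K) :
    mixedDiff (fun B => ∑ j ∈ s, f j B) A = ∑ j ∈ s, mixedDiff (f j) A := by
  simp only [mixedDiff, mul_sum]
  exact sum_comm

theorem mixedDiff_sub (f g : Finset K → ℝ) (A : Finset K) :
    mixedDiff (fun B => f B - g B) A = mixedDiff f A - mixedDiff g A := by
  simp only [mixedDiff, mul_sub, sum_sub_distrib]

theorem sum_powerset_mixedDiff (f : Finset K → ℝ) (S : Finset K) :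
    ∑ A ∈ S.powerset, mixedDiff f A = f S := by
  induction S using Finset.induction_on generalizing f with
  | empty => simp [mixedDiff_empty]
  | insert m S hm ih =>
    rw [sum_powerset_insert hm, ih,
      sum_congr rfl fun A hA => mixedDiff_insert f fun h => hm (mem_powerset.1 hA h), ih]
    ring

theorem abs_mixedDiff_le_of_hasDerivAt {F : ℕ → ℝ → ℝ} {R : ℝ} {b : ℕ → ℝ}
    (hF : ∀ n, ∀ y ∈ Set.Icc 0 R, HasDerivAt (F n) (F (n + 1) y) y)
    (hb : ∀ n, ∀ y ∈ Set.Icc 0 R, |F n y| ≤ b n) (a : K → ℕ) (A : Finset K) (n : ℕ) {y : ℝ}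
    (hy : 0 ≤ y) (hyR : y + ∑ m ∈ A, (a m : ℝ) ≤ R) :
    |mixedDiff (fun B => F n (y + ∑ m ∈ B, (a m : ℝ))) A| ≤
      (∏ m ∈ A, (a m : ℝ)) * b (n + A.card) := by
  induction A using Finset.induction_on generalizing n y with
  | empty =>
    rw [mixedDiff_empty, prod_empty, one_mul, card_empty]
    rw [sum_empty] at hyR ⊢
    exact hb n _ ⟨by linarith, hyR⟩
  | insert m A hm ih =>
    rw [sum_insert hm] at hyR
    have hnn : ∀ B : Finset K, 0 ≤ ∑ m ∈ B, (a m : ℝ) := fun B => sum_nonneg fun _ _ => by positivity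
    have hle : ∀ B ⊆ A, ∑ m ∈ B, (a m : ℝ) ≤ ∑ m ∈ A, (a m : ℝ) := fun B hB =>
      sum_le_sum_of_subset_of_nonneg hB fun _ _ _ => by positivity
    set h : ℝ → ℝ := fun z => mixedDiff (fun B => F n (z + ∑ m ∈ B, (a m : ℝ))) A with hh
    have hderiv : ∀ z ∈ Set.Icc y (y + a m),
        HasDerivAt h (mixedDiff (fun B => F (n + 1) (z + ∑ m ∈ B, (a m : ℝ))) A) z := by
      intro z hz
      refine HasDerivAt.fun_sum fun B hB => HasDerivAt.const_mul _ ?_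
      refine HasDerivAt.comp_add_const _ _ (hF n _ ⟨?_, ?_⟩)
      · linarith [hnn B, hz.1]
      · linarith [hle B (mem_powerset.1 hB), hz.2]
    have hbound : ∀ z ∈ Set.Icc y (y + a m),
        ‖mixedDiff (fun B => F (n + 1) (z + ∑ m ∈ B, (a m : ℝ))) A‖ ≤
          (∏ m ∈ A, (a m : ℝ)) * b (n + 1 + A.card) := fun z hz =>
      ih (n + 1) (by linarith [hz.1]) (by linarith [hz.2])
    have ha : (0 : ℝ) ≤ a m := by positivity
    have hmv := Convex.norm_image_sub_le_of_norm_hasDerivWithin_le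
      (fun z hz => (hderiv z hz).hasDerivWithinAt) hbound (convex_Icc y (y + a m))
      (Set.left_mem_Icc.2 (by linarith)) (Set.right_mem_Icc.2 (by linarith))
    rw [mixedDiff_insert _ hm, mixedDiff_sub, prod_insert hm, card_insert_of_notMem hm]
    have e : mixedDiff (fun B => F n (y + ∑ m ∈ insert m B, (a m : ℝ))) A = h (y + a m) :=
      mixedDiff_congr fun B hB => by rw [sum_insert fun h => hm (hB h), add_assoc]
    rw [e]
    rw [add_sub_cancel_left, Real.norm_eq_abs, Real.norm_eq_abs, abs_of_nonneg ha] at hmv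
    refine hmv.trans_eq ?_
    rw [show n + (A.card + 1) = n + 1 + A.card by ring]
    ring

theorem abs_mixedDiff_sum_range_le {F : ℕ → ℝ → ℝ} {R : ℝ} {b : ℕ → ℝ}
    (hF : ∀ n, ∀ y ∈ Set.Icc 0 R, HasDerivAt (F n) (F (n + 1) y) y)
    (hb : ∀ n, ∀ y ∈ Set.Icc 0 R, |F n y| ≤ b n) (a : K → ℕ) {A : Finset K} (hA : A.Nonempty)
    (hR : ∑ m ∈ A, (a m : ℝ) ≤ R) :
    |mixedDiff (fun B => ∑ j ∈ range (∑ m ∈ B, a m), F 0 j) A| ≤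
      (∏ m ∈ A, (a m : ℝ)) * b (A.card - 1) := by
  obtain ⟨m, hmA⟩ := hA
  obtain ⟨A, hm, rfl⟩ : ∃ A', m ∉ A' ∧ insert m A' = A :=
    ⟨A.erase m, notMem_erase _ _, insert_erase hmA⟩
  rw [sum_insert hm] at hR
  rw [mixedDiff_insert _ hm, prod_insert hm, card_insert_of_notMem hm, Nat.add_sub_cancel]
  have e : mixedDiff (fun B => ∑ j ∈ range (∑ m ∈ insert m B, a m), F 0 j -
      ∑ j ∈ range (∑ m ∈ B, a m), F 0 j) A =
      ∑ j ∈ range (a m), mixedDiff (fun B => F 0 ((j : ℝ) + ∑ m ∈ B, (a m : ℝ))) A := by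
    rw [← mixedDiff_sum]
    refine mixedDiff_congr fun B hB => ?_
    rw [sum_insert fun h => hm (hB h), add_comm, sum_range_add, add_sub_cancel_left]
    refine sum_congr rfl fun j _ => ?_
    push_cast
    rw [add_comm]
  rw [e]
  refine (abs_sum_le_sum_abs _ _).trans ?_
  refine (sum_le_sum fun j hj => abs_mixedDiff_le_of_hasDerivAt hF hb a A 0 (by positivity)
    ?_).trans_eq ?_
  · have : (j : ℝ) ≤ a m := by exact_mod_cast (mem_range.1 hj).le
    linarith
  · rw [sum_const, card_range, nsmul_eq_mul, zero_add, mul_assoc]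

end MixedDifferences

theorem exists_separating_finset {K : Type*} [Fintype K] [DecidableEq K] (F : Finset (Finset K))
    (hF : ∑ A ∈ F, (A.card - 1) + 2 ≤ Fintype.card K) :
    ∃ U : Finset K, U.Nonempty ∧ Uᶜ.Nonempty ∧ ∀ A ∈ F, A ⊆ U ∨ Disjoint A U := by
  have key : ∃ c : K → K, (∀ A ∈ F, ∀ x ∈ A, ∀ y ∈ A, c x = c y) ∧
      Fintype.card K ≤ (univ.image c).card + ∑ A ∈ F, (A.card - 1) := by
    clear hF
    induction F using Finset.induction_on with
    | empty => exact ⟨id, by simp, by simp⟩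
    | insert A F hA ih =>
      obtain ⟨c, hc, hcard⟩ := ih
      rw [sum_insert hA]
      rcases A.eq_empty_or_nonempty with rfl | ⟨a, ha⟩
      · exact ⟨c, by simpa using hc, by simpa using hcard⟩
      refine ⟨fun x => if c x ∈ A.image c then c a else c x, ?_, ?_⟩
      · rw [forall_mem_insert]
        dsimp only
        refine ⟨fun x hx y hy => ?_, fun B hB x hx y hy => ?_⟩
        · rw [if_pos (mem_image_of_mem c hx), if_pos (mem_image_of_mem c hy)]
        · rw [hc B hB x hx y hy]
      · have hsub : insert (c a) (univ.image c \ A.image c) ⊆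
            univ.image fun x => if c x ∈ A.image c then c a else c x := by
          intro v hv
          rcases mem_insert.1 hv with rfl | hv
          · exact mem_image.2 ⟨a, mem_univ _, by rw [if_pos (mem_image_of_mem c ha)]⟩
          · obtain ⟨hv1, hv2⟩ := mem_sdiff.1 hv
            obtain ⟨x, -, rfl⟩ := mem_image.1 hv1
            exact mem_image.2 ⟨x, mem_univ _, by rw [if_neg hv2]⟩
        have h1 := card_le_card hsub
        rw [card_insert_of_notMem fun h => (mem_sdiff.1 h).2 (mem_image_of_mem c ha)] at h1
        have h2 := card_sdiff_add_card_eq_card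
          (image_subset_image (f := c) (subset_univ A))
        have h3 : (A.image c).card ≤ A.card := card_image_le
        have h4 : 0 < A.card := card_pos.2 ⟨a, ha⟩
        omega
  obtain ⟨c, hc, hcard⟩ := key
  obtain ⟨u, hu, v, hv, huv⟩ := one_lt_card.1 (show 1 < (univ.image c).card by omega)
  obtain ⟨x, -, rfl⟩ := mem_image.1 hu
  obtain ⟨y, -, rfl⟩ := mem_image.1 hv
  refine ⟨univ.filter fun z => c z = c x, ⟨x, by simp⟩, ⟨y, by simpa using huv.symm⟩, fun A hA => ?_⟩
  by_cases h : ∃ z ∈ A, c z = c x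
  · obtain ⟨z, hz, hzx⟩ := h
    left
    intro w hw
    rw [mem_filter]
    exact ⟨mem_univ _, (hc A hA w hw z hz).trans hzx⟩
  · right
    rw [disjoint_left]
    intro z hz hz'
    exact h ⟨z, hz, (mem_filter.1 hz').2⟩

section ClusterExpansion

theorem abs_exp_sub_one_le_mul_exp (z : ℝ) : |Real.exp z - 1| ≤ |z| * Real.exp |z| := by
  rcases le_total 0 z with hz | hz
  · rw [abs_of_nonneg hz, abs_of_nonneg (by linarith [Real.add_one_le_exp z])]
    have h1 := Real.add_one_le_exp (-z)
    have h2 : Real.exp (-z) * Real.exp z = 1 := by rw [← Real.exp_add]; simp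
    nlinarith [Real.exp_pos z]
  · have h1 := Real.add_one_le_exp z
    have h2 : Real.exp z ≤ 1 := Real.exp_le_one_iff.2 hz
    rw [abs_of_nonpos (by linarith : Real.exp z - 1 ≤ 0), abs_of_nonpos hz]
    have h3 : 1 ≤ Real.exp (-z) := Real.one_le_exp (by linarith)
    nlinarith

theorem cumulantOn_mul_exp_sum {ι K : Type*} [DecidableEq ι] (W : Finset ι → ℝ)
    (T : Finset K → Finset ι → ℝ) (S : Finset ι) (G : Finset (Finset K)) :
    cumulantOn S (fun Δ => W Δ * Real.exp (∑ A ∈ G, T A Δ)) =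
      ∑ P ∈ partitionsOf S, (-1 : ℝ) ^ (P.card - 1) * ((P.card - 1).factorial : ℝ) *
        ((∏ C ∈ P, W C) * ∏ A ∈ G, Real.exp (∑ C ∈ P, T A C)) := by
  refine sum_congr rfl fun P _ => ?_
  rw [prod_mul_distrib, ← Real.exp_sum, ← Real.exp_sum, sum_comm]

theorem cumulantOn_cluster_eq_zero {ι K : Type*} [Fintype ι] [DecidableEq ι] [Fintype K]
    [DecidableEq K] {W : Finset ι → ℝ} {T : Finset K → Finset ι → ℝ} {col : ι → K}
    (hcol : Function.Surjective col) (hW0 : W ∅ = 1) (hT0 : ∀ A, T A ∅ = 0)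
    (hW : ∀ (U : Finset K) (Δ : Finset ι),
      W Δ = W (Δ.filter fun h => col h ∈ U) * W (Δ.filter fun h => col h ∉ U))
    (hT : ∀ A Δ, T A Δ = T A (Δ.filter fun h => col h ∈ A)) {G : Finset (Finset K)}
    (hG : ∑ A ∈ G, (A.card - 1) + 2 ≤ Fintype.card K) :
    cumulantOn univ (fun Δ => W Δ * Real.exp (∑ A ∈ G, T A Δ)) = 0 := by
  obtain ⟨U, ⟨u, hu⟩, ⟨v, hv⟩, hUG⟩ := exists_separating_finset G hG
  obtain ⟨x, rfl⟩ := hcol u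
  obtain ⟨y, rfl⟩ := hcol v
  rw [mem_compl] at hv
  refine cumulantOn_eq_zero ?_ (univ.filter fun h => col h ∈ U) (fun Δ => ?_) univ
    ⟨x, by simpa using hu⟩ ⟨y, by simpa using hv⟩
  · simp [hW0, hT0]
  · have e1 : Δ ∩ univ.filter (fun h => col h ∈ U) = Δ.filter fun h => col h ∈ U := by ext; simp
    have e2 : Δ \ univ.filter (fun h => col h ∈ U) = Δ.filter fun h => col h ∉ U := by ext; simp
    have e3 : ∑ A ∈ G, T A Δ = ∑ A ∈ G, T A (Δ.filter fun h => col h ∈ U) +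
        ∑ A ∈ G, T A (Δ.filter fun h => col h ∉ U) := by
      rw [← sum_add_distrib]
      refine sum_congr rfl fun A hA => ?_
      rw [hT A (Δ.filter fun h => col h ∈ U), hT A (Δ.filter fun h => col h ∉ U), hT A Δ,
        filter_filter, filter_filter]
      rcases hUG A hA with h | h
      · rw [filter_false_of_mem (p := fun a => col a ∉ U ∧ col a ∈ A) fun a _ ha => ha.1 (h ha.2),
          hT0, add_zero]
        congr 1
        exact filter_congr fun a _ => ⟨fun ha => ⟨h ha, ha⟩, fun ha => ha.2⟩
      · rw [filter_false_of_mem (p := fun a => col a ∈ U ∧ col a ∈ A) fun a _ ha =>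
          disjoint_left.1 h ha.2 ha.1, hT0, zero_add]
        congr 1
        exact filter_congr fun a _ => ⟨fun ha => ⟨disjoint_left.1 h ha, ha⟩, fun ha => ha.2⟩
    simp only [e1, e2]
    rw [hW U Δ, e3, Real.exp_add]
    ring

/-- Cumulants whose moments factor over colours up to interactions `T A` of size `x ^ (#A - 1)`
are small. -/
theorem exists_abs_cumulantOn_cluster_le (ι K : Type*) [Fintype ι] [DecidableEq ι] [Fintype K]
    [DecidableEq K] (b : ℝ) (hb : 0 ≤ b) :
    ∃ c : ℝ, 0 ≤ c ∧ ∀ (W : Finset ι → ℝ) (T : Finset K → Finset ι → ℝ) (col : ι → K) (w x : ℝ),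
      Function.Surjective col → W ∅ = 1 → (∀ A, T A ∅ = 0) →
      (∀ (U : Finset K) (Δ : Finset ι),
        W Δ = W (Δ.filter fun h => col h ∈ U) * W (Δ.filter fun h => col h ∉ U)) →
      (∀ A Δ, T A Δ = T A (Δ.filter fun h => col h ∈ A)) → 0 ≤ x → x ≤ 1 → 0 ≤ w →
      (∀ P ∈ partitionsOf (univ : Finset ι), |∏ C ∈ P, W C| ≤ w) →
      (∀ A Δ, |T A Δ| ≤ b * x ^ (A.card - 1)) →
      |cumulantOn univ (fun Δ => W Δ * Real.exp (∑ A, T A Δ))| ≤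
        c * (w * x ^ (Fintype.card K - 1)) := by
  set n : ℝ := ((Fintype.card (Finset ι) : ℕ) : ℝ) with hn
  set β : ℝ := n * b * Real.exp (n * b) with hβ
  have hn0 : 0 ≤ n := by positivity
  have hβ0 : 0 ≤ β := by positivity
  refine ⟨∑ G ∈ (univ : Finset (Finset K)).powerset, ∑ P ∈ partitionsOf (univ : Finset ι),
    ((P.card - 1).factorial : ℝ) * β ^ G.card, by positivity, ?_⟩
  intro W T col w x hcol hW0 hT0 hW hT hx0 hx1 hw hWw hTb
  have hz : ∀ P : Finset (Finset ι), ∀ A,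
      |Real.exp (∑ C ∈ P, T A C) - 1| ≤ β * x ^ (A.card - 1) := by
    intro P A
    have h1 : |∑ C ∈ P, T A C| ≤ n * b * x ^ (A.card - 1) := by
      refine (abs_sum_le_sum_abs _ _).trans ((sum_le_sum fun C _ => hTb A C).trans ?_)
      rw [sum_const, nsmul_eq_mul, ← mul_assoc]
      have : (P.card : ℝ) ≤ n := Nat.cast_le.2 (card_le_univ P)
      gcongr
    have h2 : |∑ C ∈ P, T A C| ≤ n * b :=
      h1.trans (mul_le_of_le_one_right (by positivity) (pow_le_one₀ hx0 hx1))
    refine (abs_exp_sub_one_le_mul_exp _).trans ?_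
    calc _ ≤ n * b * x ^ (A.card - 1) * Real.exp (n * b) := by gcongr
      _ = _ := by rw [hβ]; ring
  let δ : Finset (Finset K) → ℝ := fun G => ∑ P ∈ partitionsOf (univ : Finset ι),
    (-1 : ℝ) ^ (P.card - 1) * ((P.card - 1).factorial : ℝ) *
      ((∏ C ∈ P, W C) * ∏ A ∈ G, (Real.exp (∑ C ∈ P, T A C) - 1))
  have hsum : cumulantOn univ (fun Δ => W Δ * Real.exp (∑ A, T A Δ)) =
      ∑ G ∈ (univ : Finset (Finset K)).powerset, δ G := by
    rw [cumulantOn_mul_exp_sum, sum_comm]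
    refine sum_congr rfl fun P _ => ?_
    rw [← mul_sum, ← mul_sum, ← prod_one_add]
    simp only [add_sub_cancel]
  have hzero : ∀ G : Finset (Finset K), ∑ A ∈ G, (A.card - 1) + 2 ≤ Fintype.card K → δ G = 0 := by
    intro G hG
    have : δ G = ∑ t ∈ G.powerset, (-1) ^ t.card *
        cumulantOn univ (fun Δ => W Δ * Real.exp (∑ A ∈ G \ t, T A Δ)) := by
      simp only [cumulantOn_mul_exp_sum, mul_sum, δ, prod_sub, prod_const_one, mul_one]
      rw [sum_comm]
      refine sum_congr rfl fun P _ => sum_congr rfl fun t _ => ?_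
      ring
    rw [this]
    refine sum_eq_zero fun t _ => ?_
    rw [cumulantOn_cluster_eq_zero hcol hW0 hT0 hW hT, mul_zero]
    refine le_trans ?_ hG
    gcongr
    exact sdiff_subset
  rw [hsum, sum_mul]
  refine (abs_sum_le_sum_abs _ _).trans (sum_le_sum fun G _ => ?_)
  rcases le_or_gt (∑ A ∈ G, (A.card - 1) + 2) (Fintype.card K) with h | h
  · rw [hzero G h, abs_zero]
    positivity
  · rw [sum_mul]
    refine (abs_sum_le_sum_abs _ _).trans (sum_le_sum fun P hP => ?_)
    have h1 : |∏ A ∈ G, (Real.exp (∑ C ∈ P, T A C) - 1)| ≤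
        β ^ G.card * x ^ (Fintype.card K - 1) := by
      rw [abs_prod]
      refine (prod_le_prod (fun _ _ => abs_nonneg _) fun A _ => hz P A).trans ?_
      rw [prod_mul_distrib, prod_const, prod_pow_eq_pow_sum]
      gcongr 1
      exact pow_le_pow_of_le_one hx0 hx1 (by omega)
    rw [abs_mul, abs_mul, abs_mul, abs_pow, abs_neg, abs_one, one_pow, one_mul, Nat.abs_cast]
    calc _ ≤ ((P.card - 1).factorial : ℝ) * (w * (β ^ G.card * x ^ (Fintype.card K - 1))) := by
          gcongr
          exact hWw P hP
      _ = _ := by ring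

end ClusterExpansion

section FallingLog

/-- `fallingLog θ N 0 y` is the logarithm of `N / (θ + N - 1 - y)`, and `fallingLog θ N n` is its
`n`-th derivative. -/
def fallingLog (θ : ℝ) (N : ℕ) : ℕ → ℝ → ℝ
  | 0, y => -Real.log ((θ + N - 1 - y) / N)
  | n + 1, y => (n.factorial : ℝ) / (θ + N - 1 - y) ^ (n + 1)

theorem hasDerivAt_fallingLog {θ : ℝ} {N : ℕ} (hN : 0 < N) (n : ℕ) {y : ℝ}
    (hy : y < θ + N - 1) : HasDerivAt (fallingLog θ N n) (fallingLog θ N (n + 1) y) y := by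
  have hN' : (N : ℝ) ≠ 0 := by positivity
  have hpos : θ + N - 1 - y ≠ 0 := by linarith
  have hlin : HasDerivAt (fun y : ℝ => θ + N - 1 - y) (-1) y := by
    simpa using (hasDerivAt_id y).const_sub (θ + N - 1)
  cases n with
  | zero =>
    refine (((hlin.div_const (N : ℝ)).log (div_ne_zero hpos hN')).neg).congr_deriv ?_
    rw [fallingLog]
    field_simp
    simp
  | succ n =>
    refine ((hasDerivAt_const y (n.factorial : ℝ)).div (hlin.pow (n + 1))
      (pow_ne_zero _ hpos)).congr_deriv ?_
    rw [fallingLog, Nat.factorial_succ]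
    push_cast
    simp only [Pi.pow_apply]
    field_simp
    ring

theorem abs_fallingLog_le {θ : ℝ} (hθ : 0 < θ) {N : ℕ} (hN : 0 < N) (n : ℕ) {y : ℝ} (hy : 0 ≤ y)
    (hyN : 2 * y + 2 ≤ N) :
    |fallingLog θ N n y| ≤ (1 + θ) * n.factorial * 2 ^ n * (1 / (N : ℝ)) ^ n := by
  have hN' : (0 : ℝ) < N := by positivity
  have hlow : (N : ℝ) / 2 ≤ θ + N - 1 - y := by linarith
  have hpos : 0 < θ + N - 1 - y := by linarith
  cases n with
  | zero =>
    have hz : 0 < (θ + N - 1 - y) / N := by positivity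
    have hz1 : (θ + N - 1 - y) / N ≤ 1 + θ := by
      rw [div_le_iff₀ hN']
      nlinarith
    have hz2 : ((θ + N - 1 - y) / N)⁻¹ ≤ 2 := by
      rw [inv_div, div_le_iff₀ hpos]
      linarith
    have h1 := Real.log_le_sub_one_of_pos hz
    have h2 := Real.log_le_sub_one_of_pos (inv_pos.2 hz)
    rw [Real.log_inv] at h2
    rw [fallingLog, Nat.factorial_zero, abs_neg, abs_le]
    simp only [Nat.cast_one, mul_one, pow_zero]
    constructor <;> linarith
  | succ n =>
    rw [fallingLog, abs_of_nonneg (by positivity), Nat.factorial_succ]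
    have h1 : (n.factorial : ℝ) / (θ + N - 1 - y) ^ (n + 1) ≤
        (n.factorial : ℝ) / ((N : ℝ) / 2) ^ (n + 1) := by gcongr
    have h2 : (n.factorial : ℝ) / ((N : ℝ) / 2) ^ (n + 1) =
        1 * n.factorial * 2 ^ (n + 1) * (1 / (N : ℝ)) ^ (n + 1) := by
      rw [div_pow, div_pow, one_pow]
      field_simp
    rw [h2] at h1
    refine h1.trans ?_
    gcongr
    · linarith
    · exact le_mul_of_one_le_left (Nat.zero_le _) (by omega)

theorem inv_ewensFalling_eq {θ : ℝ} (hθ : 0 < θ) {N k : ℕ} (hN : 0 < N) (hk : k ≤ N) :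
    (ewensFalling θ N k)⁻¹ = (1 / (N : ℝ)) ^ k * Real.exp (∑ j ∈ range k, fallingLog θ N 0 j) := by
  have hN' : (0 : ℝ) < N := by positivity
  rw [Real.exp_sum, ewensFalling, ← prod_inv_distrib, ← card_range k, ← prod_const, card_range,
    ← prod_mul_distrib]
  refine prod_congr rfl fun j hj => ?_
  have hj' : ((j + 1 : ℕ) : ℝ) ≤ N := Nat.cast_le.2 ((mem_range.1 hj).trans_le hk)
  push_cast at hj'
  have hpos : 0 < θ + N - 1 - j := by linarith
  rw [fallingLog, Real.exp_neg, Real.exp_log (by positivity)]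
  field_simp

end FallingLog

section EdgeFamilies

theorem disjoint_of_edgeDisjoint {α : Type*} {p q : Finset (α × α)}
    (h : ∀ x ∈ p, ∀ y ∈ q, EdgeDisjoint x y) : Disjoint p q :=
  disjoint_left.2 fun x hx hy => (h x hx x hy).1 rfl

theorem edgeDisjoint_biUnion {α ι K : Type*} [DecidableEq α] {e : ι → Finset (α × α)} {col : ι → K}
    (he : ∀ h h', col h ≠ col h' → ∀ x ∈ e h, ∀ y ∈ e h', EdgeDisjoint x y) {Δ Δ' : Finset ι}
    (hΔ : ∀ h ∈ Δ, ∀ h' ∈ Δ', col h ≠ col h') :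
    ∀ x ∈ Δ.biUnion e, ∀ y ∈ Δ'.biUnion e, EdgeDisjoint x y := by
  intro x hx y hy
  obtain ⟨h, hh, hx⟩ := mem_biUnion.1 hx
  obtain ⟨h', hh', hy⟩ := mem_biUnion.1 hy
  exact he h h' (hΔ h hh h' hh') x hx y hy

theorem card_biUnion_eq_sum_color {α ι K : Type*} [DecidableEq α] [Fintype K] [DecidableEq K]
    {e : ι → Finset (α × α)} {col : ι → K}
    (he : ∀ h h', col h ≠ col h' → ∀ x ∈ e h, ∀ y ∈ e h', EdgeDisjoint x y) (Δ : Finset ι) :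
    (Δ.biUnion e).card = ∑ m, ((Δ.filter fun h => col h = m).biUnion e).card := by
  rw [← card_biUnion]
  · congr 1
    ext x
    simp
  · intro m _ m' _ hmm
    refine disjoint_of_edgeDisjoint (edgeDisjoint_biUnion he fun h hh h' hh' => ?_)
    rwa [(mem_filter.1 hh).2, (mem_filter.1 hh').2]

/-- The interaction between the colours in `A` inside `Δ` caused by the falling factorial. -/
def interaction {N : ℕ} {ι K : Type*} [DecidableEq K] (θ : ℝ) (e : ι → Finset (Fin N × Fin N))
    (col : ι → K) (A : Finset K) (Δ : Finset ι) : ℝ :=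
  mixedDiff (fun B => ∑ j ∈ range (∑ m ∈ B, ((Δ.filter fun h => col h = m).biUnion e).card),
    fallingLog θ N 0 j) A

theorem sum_interaction {N : ℕ} {ι K : Type*} [Fintype K] [DecidableEq K] (θ : ℝ)
    {e : ι → Finset (Fin N × Fin N)} {col : ι → K}
    (he : ∀ h h', col h ≠ col h' → ∀ x ∈ e h, ∀ y ∈ e h', EdgeDisjoint x y) (Δ : Finset ι) :
    ∑ A, interaction θ e col A Δ = ∑ j ∈ range (Δ.biUnion e).card, fallingLog θ N 0 j := by
  rw [card_biUnion_eq_sum_color he, ← sum_powerset_mixedDiff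
    (fun B => ∑ j ∈ range (∑ m ∈ B, ((Δ.filter fun h => col h = m).biUnion e).card),
      fallingLog θ N 0 j) univ, powerset_univ]
  rfl

theorem abs_interaction_le {N : ℕ} {ι K : Type*} [Fintype K] [DecidableEq K] {θ : ℝ} (hθ : 0 < θ)
    {e : ι → Finset (Fin N × Fin N)} {col : ι → K}
    (he : ∀ h h', col h ≠ col h' → ∀ x ∈ e h, ∀ y ∈ e h', EdgeDisjoint x y) {r : ℕ}
    (hN : 2 * r + 2 ≤ N) (A : Finset K) (Δ : Finset ι) (hr : (Δ.biUnion e).card ≤ r) :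
    |interaction θ e col A Δ| ≤ ((r : ℝ) + 1) ^ Fintype.card K *
      ((1 + θ) * (Fintype.card K).factorial * 2 ^ Fintype.card K) *
        (1 / (N : ℝ)) ^ (A.card - 1) := by
  rcases A.eq_empty_or_nonempty with rfl | hA
  · rw [interaction, mixedDiff_empty, sum_empty, range_zero, sum_empty, abs_zero]
    positivity
  have hN' : 2 * (r : ℝ) + 2 ≤ N := by exact_mod_cast hN
  have hN0 : 0 < N := by omega
  have hsum : ∑ m, ((Δ.filter fun h => col h = m).biUnion e).card ≤ r := by
    rwa [← card_biUnion_eq_sum_color he]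
  have hsumA : ∑ m ∈ A, ((Δ.filter fun h => col h = m).biUnion e).card ≤ r :=
    (sum_le_sum_of_subset (subset_univ A)).trans hsum
  refine (abs_mixedDiff_sum_range_le (R := r)
    (fun n y hy => hasDerivAt_fallingLog hN0 n (by linarith [hy.2]))
    (fun n y hy => abs_fallingLog_le hθ hN0 n hy.1 (by linarith [hy.2])) _ hA
    (by exact_mod_cast hsumA)).trans ?_
  have hA1 : A.card ≤ Fintype.card K := card_le_univ A
  have hprod : ∏ m ∈ A, (((Δ.filter fun h => col h = m).biUnion e).card : ℝ) ≤
      ((r : ℝ) + 1) ^ Fintype.card K := by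
    refine (prod_le_prod (fun _ _ => Nat.cast_nonneg _) (g := fun _ => (r : ℝ) + 1)
      fun m _ => ?_).trans ((prod_const _).trans_le
        (pow_le_pow_right₀ (by linarith [Nat.cast_nonneg (α := ℝ) r]) hA1))
    have : (((Δ.filter fun h => col h = m).biUnion e).card : ℝ) ≤ r :=
      Nat.cast_le.2 ((single_le_sum (f := fun m => ((Δ.filter fun h => col h = m).biUnion e).card)
        (fun _ _ => Nat.zero_le _) (mem_univ m)).trans hsum)
    linarith
  rw [mul_assoc (((r : ℝ) + 1) ^ Fintype.card K)]
  gcongr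
  · omega
  · norm_num
  · omega

theorem prod_abs_weight_le {N : ℕ} {ι : Type*} [Fintype ι] [DecidableEq ι] {θ : ℝ} (hθ : 0 < θ)
    {e : ι → Finset (Fin N × Fin N)} {r : ℕ} (hr : (univ.biUnion e).card ≤ r) {x : ℝ} (hx0 : 0 ≤ x)
    (hx1 : x ≤ 1) {P : Finset (Finset ι)} (hP : P ∈ partitionsOf (univ : Finset ι)) :
    |∏ C ∈ P, (ewensWeight θ (C.biUnion e) * x ^ (C.biUnion e).card)| ≤
      ((1 + θ) ^ r) ^ Fintype.card (Finset ι) * x ^ (univ.biUnion e).card := by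
  have hcover : univ.biUnion e ⊆ P.biUnion fun C => C.biUnion e := by
    intro y hy
    obtain ⟨h, -, hy⟩ := mem_biUnion.1 hy
    obtain ⟨C, hC, -⟩ := (mem_partitionsOf.1 hP).2.2 h (mem_univ h)
    exact mem_biUnion.2 ⟨C, hC.1, mem_biUnion.2 ⟨h, hC.2, hy⟩⟩
  have hone : 1 ≤ (1 + θ) ^ r := one_le_pow₀ (by linarith)
  rw [prod_mul_distrib, abs_mul, prod_pow_eq_pow_sum, abs_of_nonneg (pow_nonneg hx0 _), abs_prod]
  have h1 : ∏ C ∈ P, |ewensWeight θ (C.biUnion e)| ≤ ((1 + θ) ^ r) ^ Fintype.card (Finset ι) := by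
    calc _ ≤ ∏ C ∈ P, (1 + θ) ^ r := by
          refine prod_le_prod (fun _ _ => abs_nonneg _) fun C _ => ?_
          refine (abs_ewensWeight_le hθ _).trans (pow_le_pow_right₀ (by linarith) ?_)
          exact (card_le_card (biUnion_subset_biUnion_of_subset_left e (subset_univ C))).trans hr
      _ ≤ _ := by
          rw [prod_const]
          exact pow_le_pow_right₀ hone (card_le_univ P)
  have h2 : x ^ ∑ C ∈ P, (C.biUnion e).card ≤ x ^ (univ.biUnion e).card :=
    pow_le_pow_of_le_one hx0 hx1 ((card_le_card hcover).trans card_biUnion_le)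
  gcongr

theorem exists_abs_cumulantOn_contains_le_of_large {θ : ℝ} (hθ : 0 < θ) (r : ℕ) (ι K : Type*)
    [Fintype ι] [DecidableEq ι] [Fintype K] [DecidableEq K] :
    ∃ c : ℝ, 0 ≤ c ∧ ∀ N : ℕ, 2 * r + 2 ≤ N → ∀ (e : ι → Finset (Fin N × Fin N)) (col : ι → K),
      Function.Surjective col →
      (∀ h h', col h ≠ col h' → ∀ x ∈ e h, ∀ y ∈ e h', EdgeDisjoint x y) →
      (univ.biUnion e).card ≤ r →
      |cumulantOn univ (fun Δ => ewensE θ N fun σ =>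
        if ∀ x ∈ Δ.biUnion e, σ x.1 = x.2 then 1 else 0)| ≤
        c * (1 / (N : ℝ)) ^ ((univ.biUnion e).card + (Fintype.card K - 1)) := by
  obtain ⟨c, hc, hbound⟩ := exists_abs_cumulantOn_cluster_le ι K (((r : ℝ) + 1) ^ Fintype.card K *
    ((1 + θ) * (Fintype.card K).factorial * 2 ^ Fintype.card K)) (by positivity)
  refine ⟨c * ((1 + θ) ^ r) ^ Fintype.card (Finset ι), by positivity, ?_⟩
  intro N hN e col hcol he hr
  have hN0 : 0 < N := by omega
  have hN1 : (1 : ℝ) ≤ N := by exact_mod_cast hN0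
  have hx0 : (0 : ℝ) ≤ 1 / N := by positivity
  have hx1 : 1 / (N : ℝ) ≤ 1 := by
    rw [div_le_one (by positivity)]
    exact hN1
  have hcard : ∀ Δ : Finset ι, (Δ.biUnion e).card ≤ r := fun Δ =>
    (card_le_card (biUnion_subset_biUnion_of_subset_left e (subset_univ Δ))).trans hr
  have hmoment : (fun Δ => ewensE θ N fun σ =>
      if ∀ x ∈ Δ.biUnion e, σ x.1 = x.2 then 1 else 0) =
      fun Δ => ewensWeight θ (Δ.biUnion e) * (1 / (N : ℝ)) ^ (Δ.biUnion e).card *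
        Real.exp (∑ A, interaction θ e col A Δ) := by
    funext Δ
    have hle : (Δ.biUnion e).card ≤ N := by have := hcard Δ; omega
    rw [ewensE_contains_eq_weight hθ hle, sum_interaction θ he, div_eq_mul_inv,
      inv_ewensFalling_eq hθ hN0 hle, mul_assoc]
  rw [hmoment]
  refine (hbound _ _ col (((1 + θ) ^ r) ^ Fintype.card (Finset ι) *
    (1 / (N : ℝ)) ^ (univ.biUnion e).card) (1 / N) hcol ?_ ?_ ?_ ?_ hx0 hx1 (by positivity)
    (fun P hP => prod_abs_weight_le hθ hr hx0 hx1 hP)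
    fun A Δ => abs_interaction_le hθ he hN A Δ (hcard Δ)).trans_eq ?_
  · simp [ewensWeight_empty hθ]
  · intro A
    simp [interaction, mixedDiff]
  · intro U Δ
    have hdis := edgeDisjoint_biUnion he (Δ := Δ.filter fun h => col h ∈ U)
      (Δ' := Δ.filter fun h => col h ∉ U) fun h hh h' hh' heq =>
        (mem_filter.1 hh').2 (heq ▸ (mem_filter.1 hh).2)
    have hunion : Δ.biUnion e = (Δ.filter fun h => col h ∈ U).biUnion e ∪
        (Δ.filter fun h => col h ∉ U).biUnion e := by
      rw [← union_biUnion, filter_union_filter_not_eq]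
    rw [hunion, ewensWeight_union hθ _ _ hdis, card_union_of_disjoint (disjoint_of_edgeDisjoint hdis),
      pow_add]
    ring
  · intro A Δ
    refine mixedDiff_congr fun B hB => ?_
    congr 2
    refine sum_congr rfl fun m hm => ?_
    rw [filter_filter]
    congr 2
    exact filter_congr fun h _ => ⟨fun hh => ⟨hh ▸ hB hm, hh⟩, fun hh => hh.2⟩
  · rw [pow_add]
    ring

theorem abs_cumulantOn_le_of_abs_le_one {ι : Type*} [DecidableEq ι] (S : Finset ι)
    {M : Finset ι → ℝ} (hM : ∀ Δ, |M Δ| ≤ 1) :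
    |cumulantOn S M| ≤ ∑ P ∈ partitionsOf S, ((P.card - 1).factorial : ℝ) := by
  refine (abs_sum_le_sum_abs _ _).trans (sum_le_sum fun P _ => ?_)
  rw [abs_mul, abs_mul, abs_pow, abs_neg, abs_one, one_pow, one_mul, Nat.abs_cast, abs_prod]
  exact mul_le_of_le_one_right (by positivity)
    (prod_le_one (fun _ _ => abs_nonneg _) fun C _ => hM C)

theorem exists_abs_cumulantOn_contains_le {θ : ℝ} (hθ : 0 < θ) (r : ℕ) (ι K : Type*)
    [Fintype ι] [DecidableEq ι] [Fintype K] [DecidableEq K] :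
    ∃ c : ℝ, 0 ≤ c ∧ ∀ N : ℕ, 1 ≤ N → ∀ (e : ι → Finset (Fin N × Fin N)) (col : ι → K),
      Function.Surjective col →
      (∀ h h', col h ≠ col h' → ∀ x ∈ e h, ∀ y ∈ e h', EdgeDisjoint x y) →
      (univ.biUnion e).card ≤ r →
      |cumulantOn univ (fun Δ => ewensE θ N fun σ =>
        if ∀ x ∈ Δ.biUnion e, σ x.1 = x.2 then 1 else 0)| ≤
        c * (1 / (N : ℝ)) ^ ((univ.biUnion e).card + (Fintype.card K - 1)) := by
  obtain ⟨c, hc, hlarge⟩ := exists_abs_cumulantOn_contains_le_of_large hθ r ι K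
  set d : ℝ := ∑ P ∈ partitionsOf (univ : Finset ι), ((P.card - 1).factorial : ℝ)
  refine ⟨c + d * (2 * r + 2) ^ (r + Fintype.card K), by positivity, ?_⟩
  intro N hN e col hcol he hr
  have hN0 : (0 : ℝ) < N := by exact_mod_cast hN
  rw [add_mul]
  rcases le_or_gt (2 * r + 2) N with h | h
  · exact (hlarge N h e col hcol he hr).trans (le_add_of_nonneg_right (by positivity))
  · refine (abs_cumulantOn_le_of_abs_le_one _ fun Δ => abs_ewensE_contains_le_one hθ _).trans ?_
    refine le_trans ?_ (le_add_of_nonneg_left (by positivity))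
    rw [mul_assoc]
    refine le_mul_of_one_le_right (by positivity) ?_
    have h1 : (N : ℝ) ≤ 2 * r + 2 := by exact_mod_cast h.le
    rw [one_div, inv_pow, ← div_eq_mul_inv, one_le_div (by positivity)]
    calc (N : ℝ) ^ ((univ.biUnion e).card + (Fintype.card K - 1))
        ≤ (2 * r + 2) ^ ((univ.biUnion e).card + (Fintype.card K - 1)) := by gcongr
      _ ≤ _ := pow_le_pow_right₀ (by linarith [Nat.cast_nonneg (α := ℝ) r]) (by omega)

end EdgeFamilies

theorem prod_Bis_eq_ite {N r ℓ : ℕ} (t : Fin r → Fin ℓ) (i s : Fin r → Fin N) (Δ : Finset (Fin ℓ))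
    (σ : Equiv.Perm (Fin N)) :
    ∏ h ∈ Δ, ∏ j ∈ univ.filter (fun j => t j = h), Bis (i j) (s j) σ =
      if ∀ x ∈ Δ.biUnion (fun h => (univ.filter fun j => t j = h).image fun j => (i j, s j)),
        σ x.1 = x.2 then 1 else 0 := by
  simp only [Bis, prod_ite_zero, prod_const_one]
  refine if_congr ?_ rfl rfl
  simp only [mem_biUnion, mem_image, mem_filter, mem_univ, true_and]
  constructor
  · rintro h _ ⟨a, ha, j, hj, rfl⟩
    exact h a ha j hj
  · exact fun h a ha j hj => h _ ⟨a, ha, j, hj, rfl⟩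

/-- Main lemma (Theorem 1.6): bound on joint cumulants of products of elementary events of
an Ewens random permutation.  The partition `τ` of `[r]` into `ℓ` nonempty parts is encoded
by a surjective map `t : Fin r → Fin ℓ`; `c₁` is the number of connected components of
`G₁(i,s)` and `c₂` the number of parts of the join of `τ` with the partition of `[r]` into
connected components of `G₂(i,s)`, realized as the quotient of `Fin r` by the equivalence
relation generated by "same part of `τ` or reachable in `G₂(i,s)`". -/
theorem main_cumulant_bound (θ : ℝ) (hθ : 0 < θ) (r : ℕ) (hr : 0 < r) :
    ∃ C : ℝ, ∀ (ℓ : ℕ) (t : Fin r → Fin ℓ), Function.Surjective t →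
      ∀ N : ℕ, 1 ≤ N → ∀ i s : Fin r → Fin N,
        |cumulantOn (Finset.univ : Finset (Fin ℓ))
            (fun Δ => ewensE θ N (fun σ =>
              ∏ h ∈ Δ, ∏ j ∈ Finset.univ.filter (fun j => t j = h), Bis (i j) (s j) σ))|
          ≤ C * (N : ℝ) ^
              (1 - (Nat.card
                      (SimpleGraph.fromRel
                        (fun j h : Fin r => i j = i h ∧ s j = s h)).ConnectedComponent : ℤ)
                 - (Nat.card (Quot (fun j h : Fin r => t j = t h ∨
                      (SimpleGraph.fromRel (fun j h : Fin r =>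
                        i j = i h ∨ i j = s h ∨ s j = i h ∨ s j = s h)).Reachable j h)) : ℤ)) := by
  choose c hc hbound using fun ℓ k : ℕ => exists_abs_cumulantOn_contains_le hθ r (Fin ℓ) (Fin k)
  refine ⟨∑ ℓ ∈ range (r + 1), ∑ k ∈ range (r + 1), c ℓ k, fun ℓ t ht N hN i s => ?_⟩
  set R : Fin r → Fin r → Prop := fun j h => t j = t h ∨
    (SimpleGraph.fromRel (fun j h : Fin r =>
      i j = i h ∨ i j = s h ∨ s j = i h ∨ s j = s h)).Reachable j h
  set G := SimpleGraph.fromRel (fun j h : Fin r => i j = i h ∧ s j = s h)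
  set e : Fin ℓ → Finset (Fin N × Fin N) :=
    fun h => (univ.filter fun j => t j = h).image fun j => (i j, s j)
  have : Finite (Quot R) := Quot.finite R
  have : Nonempty (Quot R) := ⟨Quot.mk R ⟨0, hr⟩⟩
  have hℓr : ℓ ≤ r := by simpa using Fintype.card_le_of_surjective t ht
  have hkr : Nat.card (Quot R) ≤ r := by
    simpa using Nat.card_le_card_of_surjective _ (Quot.mk_surjective (r := R))
  have hk : 0 < Nat.card (Quot R) := Nat.card_pos
  let φ : Quot R ≃ Fin (Nat.card (Quot R)) := Finite.equivFin _
  let u := Function.surjInv ht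
  have hu : ∀ h, t (u h) = h := Function.surjInv_eq ht
  have hmk : ∀ j, Quot.mk R (u (t j)) = Quot.mk R j := fun j => Quot.sound (Or.inl (hu (t j)))
  have hcol : Function.Surjective fun h => φ (Quot.mk R (u h)) := by
    refine φ.surjective.comp fun q => ?_
    obtain ⟨j, rfl⟩ := Quot.exists_rep q
    exact ⟨t j, hmk j⟩
  have he : ∀ h h', φ (Quot.mk R (u h)) ≠ φ (Quot.mk R (u h')) →
      ∀ x ∈ e h, ∀ y ∈ e h', EdgeDisjoint x y := by
    intro h h' hne x hx y hy
    obtain ⟨j, hj, rfl⟩ := mem_image.1 hx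
    obtain ⟨j', hj', rfl⟩ := mem_image.1 hy
    obtain rfl := (mem_filter.1 hj).2
    obtain rfl := (mem_filter.1 hj').2
    rw [hmk, hmk] at hne
    have hnR : ¬R j j' := fun h => hne (congrArg φ (Quot.sound h))
    have hjj : j ≠ j' := fun h => hne (h ▸ rfl)
    have hnadj : ¬(i j = i j' ∨ i j = s j' ∨ s j = i j' ∨ s j = s j') := fun h =>
      hnR (Or.inr (SimpleGraph.Adj.reachable
        ((SimpleGraph.fromRel_adj _ _ _).2 ⟨hjj, Or.inl h⟩)))
    simpa only [EdgeDisjoint, ne_eq, not_or] using hnadj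
  have huniv : univ.biUnion e = univ.image fun j => (i j, s j) := by
    ext x
    simp [e]
  have hcard : (univ.biUnion e).card ≤ r := by
    rw [huniv]
    exact card_image_le.trans (by simp)
  have hc1 : Nat.card G.ConnectedComponent ≤ (univ.biUnion e).card := by
    have hinj : Function.Injective fun C : G.ConnectedComponent =>
        (⟨(i C.out, s C.out), by rw [huniv]; exact mem_image_of_mem _ (mem_univ _)⟩ :
          univ.biUnion e) := by
      intro C D hCD
      obtain ⟨h1, h2⟩ := Prod.mk.inj (Subtype.mk.inj hCD)
      rw [← C.out_eq, ← D.out_eq]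
      by_cases h : C.out = D.out
      · rw [h]
      · exact SimpleGraph.ConnectedComponent.sound (SimpleGraph.Adj.reachable
          ((SimpleGraph.fromRel_adj _ _ _).2 ⟨h, Or.inl ⟨h1, h2⟩⟩))
    exact (Nat.card_le_card_of_injective _ hinj).trans_eq (Nat.card_eq_finsetCard _)
  have hmain := hbound ℓ (Nat.card (Quot R)) N hN e _ hcol he hcard
  simp only [prod_Bis_eq_ite]
  have hN1 : (1 : ℝ) ≤ N := by exact_mod_cast hN
  have hconst : c ℓ (Nat.card (Quot R)) ≤ ∑ ℓ ∈ range (r + 1), ∑ k ∈ range (r + 1), c ℓ k :=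
    (single_le_sum (fun k _ => hc ℓ k) (mem_range.2 (Nat.lt_succ_of_le hkr))).trans
      (single_le_sum (f := fun ℓ => ∑ k ∈ range (r + 1), c ℓ k)
        (fun ℓ _ => sum_nonneg fun k _ => hc ℓ k) (mem_range.2 (Nat.lt_succ_of_le hℓr)))
  have hpow : (1 / (N : ℝ)) ^
      ((univ.biUnion e).card + (Fintype.card (Fin (Nat.card (Quot R))) - 1)) ≤
      (N : ℝ) ^ (1 - (Nat.card G.ConnectedComponent : ℤ) - (Nat.card (Quot R) : ℤ)) := by
    rw [one_div, inv_pow, ← zpow_natCast, ← zpow_neg, Fintype.card_fin]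
    exact zpow_le_zpow_right₀ hN1 (by omega)
  exact hmain.trans (mul_le_mul hconst hpow (by positivity)
    (sum_nonneg fun ℓ _ => sum_nonneg fun k _ => hc ℓ k))

end
end

section
/- Fix θ > 0 and a positive integer p. For each N, let σ_N be an Ewens(θ)-distributed random permutation of S_N, and for each p' ≤ p let Γ^{(N)}_{p'} be the number of cycles of length p' of σ_N. Then the random vector (Γ^{(N)}_1, …, Γ^{(N)}_p) converges in distribution, as N → ∞, to a vector (P_1, …, P_p) of independent Poisson random variables where P_{p'} has parameter θ/p'. -/
open scoped BigOperators Classical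
open Finset

noncomputable section

/-- Number of cycles of length `p` of a permutation of `Fin N` (fixed points are the cycles
of length 1). -/
def cyclesOfLength {N : ℕ} (p : ℕ) (σ : Equiv.Perm (Fin N)) : ℕ :=
  if p = 1 then N - σ.cycleType.sum else Multiset.count p σ.cycleType

/-- The power series `∑ c, g c * X ^ (i * c)`. -/
def dilate (i : ℕ) (g : ℕ → ℝ) : PowerSeries ℝ :=
  PowerSeries.mk fun m => if i ∣ m then g (m / i) else 0

/-- The power series `exp (s * X ^ i)`. -/
def expMonomial (s : ℝ) (i : ℕ) : PowerSeries ℝ :=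
  dilate i fun c => s ^ c / (c.factorial : ℝ)

lemma coeff_dilate_mul {i : ℕ} (hi : 0 < i) (g : ℕ → ℝ) (c : ℕ) :
    PowerSeries.coeff (i * c) (dilate i g) = g c := by
  simp [dilate, Nat.mul_div_cancel_left c hi]

lemma coeff_dilate_of_not_dvd {i m : ℕ} (h : ¬ i ∣ m) (g : ℕ → ℝ) :
    PowerSeries.coeff m (dilate i g) = 0 := by
  simp [dilate, h]

lemma constantCoeff_expMonomial (s : ℝ) (i : ℕ) :
    PowerSeries.constantCoeff (expMonomial s i) = 1 := by
  rw [← PowerSeries.coeff_zero_eq_constantCoeff_apply]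
  simp [expMonomial, dilate]

lemma coeff_X_mul_derivative (f : PowerSeries ℝ) (n : ℕ) :
    PowerSeries.coeff n (PowerSeries.X * PowerSeries.derivative ℝ f)
      = n * PowerSeries.coeff n f := by
  cases n with
  | zero => simp
  | succ n =>
    rw [PowerSeries.coeff_succ_X_mul, PowerSeries.coeff_derivative, mul_comm]
    push_cast
    rfl

lemma X_mul_derivative_expMonomial (s : ℝ) {i : ℕ} (hi : 0 < i) :
    PowerSeries.X * PowerSeries.derivative ℝ (expMonomial s i)
      = PowerSeries.C (s * i) * PowerSeries.X ^ i * expMonomial s i := by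
  ext n
  rw [mul_assoc, PowerSeries.coeff_C_mul, PowerSeries.coeff_X_pow_mul',
    coeff_X_mul_derivative]
  by_cases hd : i ∣ n
  · obtain ⟨c, rfl⟩ := hd
    rw [expMonomial, coeff_dilate_mul hi]
    cases c with
    | zero => simp [hi.ne']
    | succ c =>
      have h : i * (c + 1) - i = i * c := by rw [mul_add, mul_one, Nat.add_sub_cancel]
      rw [if_pos (by nlinarith), h, coeff_dilate_mul hi, Nat.factorial_succ]
      have := Nat.factorial_ne_zero c
      push_cast
      field_simp
      ring
  · rw [expMonomial, coeff_dilate_of_not_dvd hd]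
    split_ifs with h
    · rw [coeff_dilate_of_not_dvd]
      · simp
      · rwa [Nat.dvd_sub_iff_left h dvd_rfl]
    · simp

lemma expMonomial_neg_mul_self (s : ℝ) {i : ℕ} (hi : 0 < i) :
    expMonomial (-s) i * expMonomial s i = 1 := by
  apply PowerSeries.derivative.ext
  · apply mul_left_cancel₀ (PowerSeries.X_ne_zero (R := ℝ))
    have h₁ := X_mul_derivative_expMonomial s hi
    have h₂ := X_mul_derivative_expMonomial (-s) hi
    rw [neg_mul, map_neg] at h₂
    rw [Derivation.leibniz, PowerSeries.derivative_one, smul_eq_mul, smul_eq_mul]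
    linear_combination expMonomial (-s) i * h₁ + expMonomial s i * h₂
  · simp [constantCoeff_expMonomial]

lemma X_mul_derivative_prod_expMonomial (θ : ℝ) (s : Finset ℕ) (hs : ∀ i ∈ s, 0 < i) :
    PowerSeries.X * PowerSeries.derivative ℝ (∏ i ∈ s, expMonomial (θ / i) i)
      = PowerSeries.C θ * (∑ i ∈ s, PowerSeries.X ^ i) * ∏ i ∈ s, expMonomial (θ / i) i := by
  induction s using Finset.induction_on with
  | empty => simp
  | insert i s his ih =>
    have hi : 0 < i := hs i (by simp)
    have h := X_mul_derivative_expMonomial (θ / i) hi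
    rw [div_mul_cancel₀ θ (by positivity)] at h
    have ih := ih fun j hj => hs j (by simp [hj])
    rw [prod_insert his, sum_insert his, Derivation.leibniz, smul_eq_mul, smul_eq_mul]
    linear_combination expMonomial (θ / i) i * ih + (∏ j ∈ s, expMonomial (θ / j) j) * h

/-- The Taylor coefficients of `(1 - X) ^ (-θ)`. -/
def risingCoeff (θ : ℝ) (n : ℕ) : ℝ :=
  (∏ k ∈ range n, (θ + (k : ℝ))) / (n.factorial : ℝ)

lemma risingCoeff_succ (θ : ℝ) (n : ℕ) :
    risingCoeff θ (n + 1) = risingCoeff θ n * ((θ + n) / (n + 1)) := by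
  have := Nat.factorial_ne_zero n
  rw [risingCoeff, risingCoeff, prod_range_succ, Nat.factorial_succ]
  push_cast
  field_simp

lemma risingCoeff_pos {θ : ℝ} (hθ : 0 < θ) (n : ℕ) : 0 < risingCoeff θ n :=
  div_pos (prod_pos fun k _ => by positivity) (by positivity)

lemma coeff_prod_expMonomial (θ : ℝ) {n N : ℕ} (hn : n ≤ N) :
    PowerSeries.coeff n (∏ i ∈ Icc 1 N, expMonomial (θ / i) i) = risingCoeff θ n := by
  set G := ∏ i ∈ Icc 1 N, expMonomial (θ / i) i with hG
  have hgeom : (∑ i ∈ Icc 1 N, (PowerSeries.X : PowerSeries ℝ) ^ i) * (1 - PowerSeries.X)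
      = PowerSeries.X * (1 - PowerSeries.X ^ N) := by
    rw [← geom_sum_mul_neg, ← mul_assoc, mul_sum, range_eq_Ico, ← Ico_add_one_right_eq_Icc,
      ← sum_Ico_add' _ 0 N 1]
    simp only [pow_succ']
  have hode : (1 - PowerSeries.X) * PowerSeries.derivative ℝ G
      = PowerSeries.C θ * (G - PowerSeries.X ^ N * G) := by
    apply mul_left_cancel₀ (PowerSeries.X_ne_zero (R := ℝ))
    have h := X_mul_derivative_prod_expMonomial θ (Icc 1 N) fun i hi => (mem_Icc.1 hi).1
    rw [← hG] at h
    linear_combination (1 - PowerSeries.X) * h + PowerSeries.C θ * G * hgeom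
  induction n with
  | zero => simp [hG, constantCoeff_expMonomial, risingCoeff]
  | succ n ih =>
    have h := congrArg (PowerSeries.coeff n) hode
    rw [sub_mul, one_mul, map_sub, coeff_X_mul_derivative, PowerSeries.coeff_derivative,
      PowerSeries.coeff_C_mul,
      map_sub, PowerSeries.coeff_X_pow_mul', if_neg (by lia), ih (by lia)] at h
    rw [risingCoeff_succ]
    have : (n : ℝ) + 1 ≠ 0 := by positivity
    field_simp
    linarith

lemma tendsto_sub_div (a : ℕ → ℝ) (ha : ∀ n, 0 < a n)
    (h₁ : Filter.Tendsto (fun n => a n / a (n + 1)) Filter.atTop (nhds 1)) (i : ℕ) :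
    Filter.Tendsto (fun n => a (n - i) / a n) Filter.atTop (nhds 1) := by
  rw [← Filter.tendsto_add_atTop_iff_nat i]
  simp only [Nat.add_sub_cancel]
  induction i with
  | zero => simp [div_self (ha _).ne']
  | succ i ih =>
    have h := ih.mul ((Filter.tendsto_add_atTop_iff_nat i).2 h₁)
    rw [one_mul] at h
    refine h.congr fun n => ?_
    rw [div_mul_div_cancel₀ (ha _).ne']
    rfl

lemma sub_le_pow_mul (a : ℕ → ℝ) {C : ℝ} (hC₀ : 0 ≤ C) (hC : ∀ n, a n ≤ C * a (n + 1)) {i n : ℕ}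
    (hin : i ≤ n) : a (n - i) ≤ C ^ i * a n := by
  obtain ⟨n, rfl⟩ := Nat.exists_eq_add_of_le' hin
  rw [Nat.add_sub_cancel]
  clear hin
  induction i with
  | zero => simp
  | succ i ih =>
    calc a n ≤ C ^ i * a (n + i) := ih
      _ ≤ C ^ i * (C * a (n + i + 1)) := by gcongr; exact hC _
      _ = C ^ (i + 1) * a (n + (i + 1)) := by rw [pow_succ, mul_assoc, add_assoc]

lemma tendsto_coeff_mul_div (a : ℕ → ℝ) (ha : ∀ n, 0 < a n) {C : ℝ} (hC₀ : 0 ≤ C)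
    (hC : ∀ n, a n ≤ C * a (n + 1))
    (h₁ : Filter.Tendsto (fun n => a n / a (n + 1)) Filter.atTop (nhds 1))
    (f g : PowerSeries ℝ) (hf : Summable fun i => |PowerSeries.coeff i f| * C ^ i) {L : ℝ}
    (hg : Filter.Tendsto (fun n => PowerSeries.coeff n g / a n) Filter.atTop (nhds L)) :
    Filter.Tendsto (fun n => PowerSeries.coeff n (f * g) / a n) Filter.atTop
      (nhds ((∑' i, PowerSeries.coeff i f) * L)) := by
  obtain ⟨K, hK⟩ : ∃ K, ∀ n, |PowerSeries.coeff n g / a n| ≤ K := by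
    obtain ⟨K, hK⟩ := (Metric.isBounded_range_of_tendsto _ hg).exists_norm_le
    exact ⟨K, fun n => hK _ ⟨n, rfl⟩⟩
  have hK₀ : 0 ≤ K := (abs_nonneg _).trans (hK 0)
  let F : ℕ → ℕ → ℝ := fun n i => if i ≤ n then
    PowerSeries.coeff i f * (PowerSeries.coeff (n - i) g / a (n - i) * (a (n - i) / a n)) else 0
  have hF : ∀ n, PowerSeries.coeff n (f * g) / a n = ∑' i, F n i := by
    intro n
    rw [tsum_eq_sum (s := range (n + 1)) fun i hi => if_neg (by simpa using hi),
      PowerSeries.coeff_mul, Nat.sum_antidiagonal_eq_sum_range_succ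
        (fun i j => PowerSeries.coeff i f * PowerSeries.coeff j g), sum_div]
    refine sum_congr rfl fun i hi => ?_
    rw [if_pos (by simpa [Nat.lt_succ_iff] using hi), div_mul_div_cancel₀ (ha _).ne', mul_div_assoc]
  rw [funext hF, ← tsum_mul_right]
  refine tendsto_tsum_of_dominated_convergence (hf.mul_left K) (fun i => ?_)
    (Filter.Eventually.of_forall fun n i => ?_)
  · have h := ((hg.comp (Filter.tendsto_sub_atTop_nat i)).mul
      (tendsto_sub_div a ha h₁ i)).const_mul (PowerSeries.coeff i f)
    rw [mul_one] at h
    refine h.congr' ?_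
    filter_upwards [Filter.eventually_ge_atTop i] with n hn
    simp [F, hn]
  · simp only [F]
    split_ifs with hin
    · rw [Real.norm_eq_abs, abs_mul, abs_mul, abs_of_pos (div_pos (ha _) (ha _))]
      calc _ ≤ |PowerSeries.coeff i f| * (K * C ^ i) := by
            have := (ha (n - i)).le
            have := (ha n).le
            gcongr
            · exact hK _
            · rw [div_le_iff₀ (ha n)]
              exact sub_le_pow_mul a hC₀ hC hin
        _ = _ := by ring
    · rw [norm_zero]
      positivity

lemma hasSum_coeff_dilate {i : ℕ} (hi : 0 < i) {g : ℕ → ℝ} {L : ℝ} (hg : HasSum g L) :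
    HasSum (fun m => PowerSeries.coeff m (dilate i g)) L := by
  have hinj : Function.Injective (fun c : ℕ => i * c) := fun _ _ h => Nat.eq_of_mul_eq_mul_left hi h
  rw [← hinj.hasSum_iff fun m hm => coeff_dilate_of_not_dvd
    (fun ⟨c, hc⟩ => hm ⟨c, hc.symm⟩) g]
  simpa [Function.comp_def, coeff_dilate_mul hi] using hg

lemma hasSum_coeff_expMonomial (s : ℝ) {i : ℕ} (hi : 0 < i) :
    HasSum (fun m => PowerSeries.coeff m (expMonomial s i)) (Real.exp s) := by
  apply hasSum_coeff_dilate hi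
  rw [Real.exp_eq_exp_ℝ]
  exact NormedSpace.expSeries_div_hasSum_exp s

lemma summable_abs_coeff_expMonomial (s : ℝ) {i : ℕ} (hi : 0 < i) (C : ℝ) :
    Summable fun m => |PowerSeries.coeff m (expMonomial s i)| * C ^ m := by
  convert (hasSum_coeff_expMonomial (|s| * C ^ i) hi).summable using 2 with m
  by_cases hd : i ∣ m
  · obtain ⟨c, rfl⟩ := hd
    rw [expMonomial, expMonomial, coeff_dilate_mul hi, coeff_dilate_mul hi, mul_pow, abs_div,
      abs_pow, Nat.abs_cast, ← pow_mul]
    ring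
  · simp [expMonomial, coeff_dilate_of_not_dvd hd]

lemma tendsto_risingCoeff_ratio {θ : ℝ} (hθ : 0 < θ) :
    Filter.Tendsto (fun n => risingCoeff θ n / risingCoeff θ (n + 1)) Filter.atTop (nhds 1) := by
  have h := tendsto_add_mul_div_add_mul_atTop_nhds (𝕜 := ℝ) 1 θ 1 one_ne_zero
  rw [div_one] at h
  refine h.congr fun n => ?_
  have := risingCoeff_pos hθ n
  rw [risingCoeff_succ]
  field_simp
  ring

lemma risingCoeff_le_mul_succ {θ : ℝ} (hθ : 0 < θ) (n : ℕ) :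
    risingCoeff θ n ≤ (1 + 1 / θ) * risingCoeff θ (n + 1) := by
  have := risingCoeff_pos hθ n
  have h : 1 ≤ (1 + 1 / θ) * ((θ + n) / (n + 1)) := by
    have : (1 + 1 / θ) * ((θ + n) / (n + 1)) = 1 + (θ ^ 2 + n) / (θ * (n + 1)) := by
      field_simp
      ring
    rw [this]
    have : 0 ≤ (θ ^ 2 + n) / (θ * (n + 1)) := by positivity
    linarith
  rw [risingCoeff_succ]
  nlinarith

lemma tendsto_coeff_prod_expMonomial_neg {θ : ℝ} (hθ : 0 < θ) (s : Finset ℕ)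
    (hs : ∀ i ∈ s, 0 < i) :
    Filter.Tendsto
      (fun n => PowerSeries.coeff n
        ((∏ i ∈ s, expMonomial (-(θ / i)) i) * PowerSeries.mk (risingCoeff θ)) / risingCoeff θ n)
      Filter.atTop (nhds (∏ i ∈ s, Real.exp (-(θ / i)))) := by
  induction s using Finset.induction_on with
  | empty => simp [div_self (risingCoeff_pos hθ _).ne']
  | insert i s his ih =>
    have hi : 0 < i := hs i (by simp)
    have hC : 0 ≤ 1 + 1 / θ := by positivity
    have h := tendsto_coeff_mul_div (risingCoeff θ) (risingCoeff_pos hθ) hC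
      (risingCoeff_le_mul_succ hθ) (tendsto_risingCoeff_ratio hθ) _ _
      (summable_abs_coeff_expMonomial (-(θ / i)) hi _) (ih fun j hj => hs j (by simp [hj]))
    rw [(hasSum_coeff_expMonomial _ hi).tsum_eq] at h
    simpa [prod_insert his, mul_assoc] using h

lemma sum_partition_prod (n : ℕ) (g : ℕ → ℕ → ℝ) :
    ∑ P : n.Partition, ∏ i ∈ Icc 1 n, g i (P.parts.count i)
      = PowerSeries.coeff n (∏ i ∈ Icc 1 n, dilate i (g i)) := by
  rw [PowerSeries.coeff_prod]
  refine sum_of_injOn Nat.Partition.toFinsuppAntidiag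
    (Nat.Partition.toFinsuppAntidiag_injective n).injOn
    (fun P _ => P.toFinsuppAntidiag_mem_finsuppAntidiag) (fun l hl hl' => ?_) fun P _ => ?_
  · by_contra hne
    have hdvd : ∀ i ∈ Icc 1 n, i ∣ l i := fun i hi => by
      by_contra hd
      exact hne (prod_eq_zero hi (coeff_dilate_of_not_dvd hd _))
    obtain ⟨hsum, hsupp⟩ := mem_finsuppAntidiag.1 hl
    refine hl' ⟨⟨∑ i ∈ Icc 1 n, Multiset.replicate (l i / i) i, fun {j} hj => ?_, ?_⟩,
      by simp, ?_⟩
    · obtain ⟨i, hi, hj⟩ := Multiset.mem_sum.1 hj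
      rw [Multiset.eq_of_mem_replicate hj]
      exact (mem_Icc.1 hi).1
    · rw [Multiset.sum_sum]
      refine Eq.trans (sum_congr rfl fun i hi => ?_) hsum
      rw [Multiset.sum_replicate, smul_eq_mul, Nat.div_mul_cancel (hdvd i hi)]
    · ext i
      by_cases hi : i ∈ Icc 1 n
      · simp [Nat.Partition.toFinsuppAntidiag, Multiset.count_sum', Multiset.count_replicate,
          (mem_Icc.1 hi).1, (mem_Icc.1 hi).2, Nat.div_mul_cancel (hdvd i hi)]
      · have : l i = 0 := by
          by_contra h
          exact hi (hsupp (by simpa using h))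
        simp [Nat.Partition.toFinsuppAntidiag, Multiset.count_sum', Multiset.count_replicate,
          this]
  · refine prod_congr rfl fun i hi => ?_
    have h : P.toFinsuppAntidiag i = i * P.parts.count i := mul_comm _ _
    rw [h, coeff_dilate_mul (mem_Icc.1 hi).1]

lemma parts_eq_filter_add_replicate {n : ℕ} (P : n.Partition) :
    P.parts = P.parts.filter (2 ≤ ·) + Multiset.replicate (P.parts.count 1) 1 := by
  conv_lhs => rw [← Multiset.filter_add_not (2 ≤ ·) P.parts]
  rw [← Multiset.filter_eq']
  congr 1
  refine Multiset.filter_congr fun i hi => ?_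
  have := P.parts_pos hi
  lia

lemma sum_filter_parts_add_count_one {n : ℕ} (P : n.Partition) :
    (P.parts.filter (2 ≤ ·)).sum + P.parts.count 1 = n := by
  have h := congrArg Multiset.sum (parts_eq_filter_add_replicate P)
  rw [P.parts_sum, Multiset.sum_add, Multiset.sum_replicate, smul_eq_mul, mul_one] at h
  exact h.symm

section Perm

variable {α : Type*} [Fintype α] [DecidableEq α]

lemma partition_eq_iff_cycleType_eq (P : (Fintype.card α).Partition) (σ : Equiv.Perm α) :
    σ.partition = P ↔ σ.cycleType = P.parts.filter (2 ≤ ·) := by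
  refine ⟨fun h => by rw [← h, Equiv.Perm.filter_parts_partition_eq_cycleType], fun h => ?_⟩
  have hP := sum_filter_parts_add_count_one P
  rw [Nat.Partition.ext_iff, Equiv.Perm.parts_partition, parts_eq_filter_add_replicate P,
    ← Equiv.Perm.sum_cycleType, h]
  congr 2
  lia

lemma card_partition_eq_mul (P : (Fintype.card α).Partition) :
    #{σ : Equiv.Perm α | σ.partition = P}
      * ∏ i ∈ Icc 1 (Fintype.card α), (i ^ P.parts.count i * (P.parts.count i).factorial)
      = (Fintype.card α).factorial := by
  set m := P.parts.filter (2 ≤ ·) with hm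
  have hP := sum_filter_parts_add_count_one P
  have hcount : ∀ i ∈ m.toFinset, P.parts.count i = m.count i := fun i hi => by
    rw [hm, Multiset.count_filter_of_pos (Multiset.mem_filter.1 (Multiset.mem_toFinset.1 hi)).2]
  have h₁ : 1 ∉ m.toFinset := by simp [hm]
  have hprod : ∏ i ∈ Icc 1 (Fintype.card α), (i ^ P.parts.count i * (P.parts.count i).factorial)
      = (Fintype.card α - m.sum).factorial * m.prod * ∏ i ∈ m.toFinset, (m.count i).factorial := by
    have hone : ∀ i, i ∉ P.parts → i ^ P.parts.count i * (P.parts.count i).factorial = 1 :=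
      fun i hi => by simp [Multiset.count_eq_zero_of_notMem hi]
    have hl := prod_subset (subset_insert 1 (Icc 1 (Fintype.card α))) fun i _ hi =>
      hone i fun h => hi (mem_Icc.2 ⟨P.parts_pos h, P.le_of_mem_parts h⟩)
    have hr : insert 1 m.toFinset ⊆ insert 1 (Icc 1 (Fintype.card α)) := by
      refine insert_subset_insert 1 fun i hi => ?_
      have h := (Multiset.mem_filter.1 (Multiset.mem_toFinset.1 hi)).1
      exact mem_Icc.2 ⟨P.parts_pos h, P.le_of_mem_parts h⟩
    have hr := prod_subset hr fun i _ hi => hone i fun h => hi <| by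
      have := P.parts_pos h
      rw [mem_insert, Multiset.mem_toFinset, hm, Multiset.mem_filter]
      by_cases h1 : i = 1
      · exact Or.inl h1
      · exact Or.inr ⟨h, by lia⟩
    rw [hl, ← hr, prod_insert h₁, prod_congr (g := fun i => i ^ m.count i * (m.count i).factorial)
        rfl fun i hi => by rw [hcount i hi],
      prod_mul_distrib, prod_multiset_count m, one_pow, one_mul, ← mul_assoc, show Fintype.card α - m.sum = P.parts.count 1 by lia]
  have hcard := Equiv.Perm.card_of_cycleType_mul_eq (α := α) m
  rw [if_pos ⟨by lia, fun i hi => (Multiset.mem_filter.1 hi).2⟩] at hcard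
  rw [hprod, ← hcard]
  congr 2
  ext σ
  simp [partition_eq_iff_cycleType_eq, hm]

lemma sum_perm_prod_count (f : ℕ → ℕ → ℝ) :
    ∑ σ : Equiv.Perm α, ∏ i ∈ Icc 1 (Fintype.card α), f i (σ.partition.parts.count i)
      = (Fintype.card α).factorial * PowerSeries.coeff (Fintype.card α)
        (∏ i ∈ Icc 1 (Fintype.card α),
          dilate i fun c => f i c / ((i : ℝ) ^ c * (c.factorial : ℝ))) := by
  rw [← sum_partition_prod _ fun i c => f i c / ((i : ℝ) ^ c * (c.factorial : ℝ)), mul_sum,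
    ← sum_fiberwise univ (fun σ : Equiv.Perm α => σ.partition)]
  refine sum_congr rfl fun P _ => ?_
  rw [sum_congr rfl fun σ hσ => by rw [(mem_filter.1 hσ).2], sum_const, nsmul_eq_mul,
    ← card_partition_eq_mul P, prod_div_distrib]
  push_cast
  rw [mul_assoc, mul_div_cancel₀]
  refine prod_ne_zero_iff.2 fun i hi => ?_
  have : (i : ℝ) ≠ 0 := by
    have := (mem_Icc.1 hi).1
    positivity
  positivity

end Perm

lemma count_parts_partition {N : ℕ} (σ : Equiv.Perm (Fin N)) (i : ℕ) :
    σ.partition.parts.count i = cyclesOfLength i σ := by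
  rw [Equiv.Perm.parts_partition, Multiset.count_add, Multiset.count_replicate, cyclesOfLength,
    ← Equiv.Perm.sum_cycleType, Fintype.card_fin]
  by_cases hi : i = 1
  · have : σ.cycleType.count 1 = 0 :=
      Multiset.count_eq_zero_of_notMem fun h => by
        simpa using Equiv.Perm.two_le_of_mem_cycleType h
    simp [hi, this]
  · simp [hi, Ne.symm hi]

lemma cycleCount_eq_sum {N : ℕ} (σ : Equiv.Perm (Fin N)) :
    cycleCount σ = ∑ i ∈ Icc 1 N, cyclesOfLength i σ := by
  simp only [← count_parts_partition]
  rw [Multiset.sum_count_eq_card fun i hi => mem_Icc.2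
    ⟨σ.partition.parts_pos hi, by simpa using σ.partition.le_of_mem_parts hi⟩,
    Equiv.Perm.parts_partition, Multiset.card_add, Multiset.card_replicate, cycleCount,
    ← Equiv.Perm.sum_cycleType, Fintype.card_fin]

lemma sum_perm_prod_cyclesOfLength (N : ℕ) (f : ℕ → ℕ → ℝ) :
    ∑ σ : Equiv.Perm (Fin N), ∏ i ∈ Icc 1 N, f i (cyclesOfLength i σ)
      = N.factorial * PowerSeries.coeff N
        (∏ i ∈ Icc 1 N, dilate i fun c => f i c / ((i : ℝ) ^ c * (c.factorial : ℝ))) := by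
  have h := sum_perm_prod_count (α := Fin N) f
  simp only [count_parts_partition] at h
  simpa only [Fintype.card_fin] using h

/-- The weight `(θ / i) ^ c / c!` of having `c` cycles of length `i`. -/
def cycleWeight (θ : ℝ) (i c : ℕ) : ℝ :=
  (θ / i) ^ c / (c.factorial : ℝ)

lemma dilate_single {i : ℕ} (hi : 0 < i) (k : ℕ) (w : ℕ → ℝ) :
    dilate i (fun c => if c = k then w c else 0)
      = PowerSeries.C (w k) * PowerSeries.X ^ (i * k) := by
  ext n
  rw [PowerSeries.coeff_C_mul, PowerSeries.coeff_X_pow]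
  by_cases hd : i ∣ n
  · obtain ⟨c, rfl⟩ := hd
    rw [coeff_dilate_mul hi]
    by_cases hc : c = k
    · simp [hc]
    · simp [hc, hi.ne']
  · rw [coeff_dilate_of_not_dvd hd, if_neg fun h => hd ⟨k, h⟩, mul_zero]

lemma ewensP_cyclesOfLength_eq (θ : ℝ) {p N : ℕ} (hpN : p ≤ N) (k : ℕ → ℕ)
    (hN : ∑ i ∈ Icc 1 p, i * k i ≤ N) :
    ewensP θ N {σ | ∀ i ∈ Icc 1 p, cyclesOfLength i σ = k i}
      = (∏ i ∈ Icc 1 p, cycleWeight θ i (k i))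
        * (PowerSeries.coeff (N - ∑ i ∈ Icc 1 p, i * k i)
          ((∏ i ∈ Icc 1 p, expMonomial (-(θ / i)) i) * PowerSeries.mk (risingCoeff θ))
          / risingCoeff θ N) := by
  have hsub : Icc 1 p ⊆ Icc 1 N := Icc_subset_Icc_right hpN
  let f : ℕ → ℕ → ℝ := fun i c => if i ∈ Icc 1 p then (if c = k i then θ ^ c else 0) else θ ^ c
  obtain ⟨A, hA⟩ : ∃ A : Set (Equiv.Perm (Fin N)),
      A = {σ | ∀ i ∈ Icc 1 p, cyclesOfLength i σ = k i} := ⟨_, rfl⟩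
  have hmem : ∀ σ, σ ∈ A ↔ ∀ i ∈ Icc 1 p, cyclesOfLength i σ = k i := by simp [hA]
  have hsum : ∑ σ : Equiv.Perm (Fin N), θ ^ cycleCount σ * (if σ ∈ A then 1 else 0)
      = ∑ σ : Equiv.Perm (Fin N), ∏ i ∈ Icc 1 N, f i (cyclesOfLength i σ) := by
    refine sum_congr rfl fun σ _ => ?_
    split_ifs with h
    · rw [hmem] at h
      rw [mul_one, cycleCount_eq_sum, ← prod_pow_eq_pow_sum]
      refine prod_congr rfl fun i _ => ?_
      by_cases hi : i ∈ Icc 1 p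
      · simp only [f, if_pos hi, if_pos (h i hi)]
      · simp only [f, if_neg hi]
    · rw [hmem] at h
      push Not at h
      obtain ⟨i, hi, hne⟩ := h
      rw [mul_zero, prod_eq_zero (hsub hi)]
      simp only [f, if_pos hi, if_neg hne]
  have hprod : ∏ i ∈ Icc 1 N, dilate i (fun c => f i c / ((i : ℝ) ^ c * (c.factorial : ℝ)))
      = PowerSeries.C (∏ i ∈ Icc 1 p, cycleWeight θ i (k i))
        * (PowerSeries.X ^ (∑ i ∈ Icc 1 p, i * k i)
          * ((∏ i ∈ Icc 1 p, expMonomial (-(θ / i)) i)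
            * ∏ i ∈ Icc 1 N, expMonomial (θ / i) i)) := by
    rw [← prod_sdiff hsub, ← prod_sdiff (f := fun i : ℕ => expMonomial (θ / i) i) hsub]
    have hlarge : ∏ i ∈ Icc 1 N \ Icc 1 p,
          dilate i (fun c => f i c / ((i : ℝ) ^ c * (c.factorial : ℝ)))
        = ∏ i ∈ Icc 1 N \ Icc 1 p, expMonomial (θ / i) i := by
      refine prod_congr rfl fun i hi => ?_
      simp only [f, if_neg (mem_sdiff.1 hi).2, expMonomial, div_pow, div_div]
    have hsmall : ∏ i ∈ Icc 1 p, dilate i (fun c => f i c / ((i : ℝ) ^ c * (c.factorial : ℝ)))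
        = PowerSeries.C (∏ i ∈ Icc 1 p, cycleWeight θ i (k i))
          * PowerSeries.X ^ (∑ i ∈ Icc 1 p, i * k i) := by
      rw [map_prod, ← prod_pow_eq_pow_sum, ← prod_mul_distrib]
      refine prod_congr rfl fun i hi => ?_
      rw [← dilate_single (mem_Icc.1 hi).1]
      simp only [f, if_pos hi, cycleWeight, ite_div, zero_div, div_pow, div_div]
    have hinv : (∏ i ∈ Icc 1 p, expMonomial (-(θ / i)) i)
        * ∏ i ∈ Icc 1 p, expMonomial (θ / i) i = 1 := by
      rw [← prod_mul_distrib]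
      exact prod_eq_one fun i hi => expMonomial_neg_mul_self _ (mem_Icc.1 hi).1
    rw [hlarge, hsmall]
    linear_combination (-(PowerSeries.C (∏ i ∈ Icc 1 p, cycleWeight θ i (k i))
      * PowerSeries.X ^ (∑ i ∈ Icc 1 p, i * k i)
      * ∏ i ∈ Icc 1 N \ Icc 1 p, expMonomial (θ / i) i)) * hinv
  rw [← hA, ewensP, ewensE, hsum, sum_perm_prod_cyclesOfLength, hprod, PowerSeries.coeff_C_mul,
    PowerSeries.coeff_X_pow_mul', if_pos hN]
  have hcoeff : ∀ (g : PowerSeries ℝ) (n : ℕ), n ≤ N →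
      PowerSeries.coeff n (g * ∏ i ∈ Icc 1 N, expMonomial (θ / i) i)
        = PowerSeries.coeff n (g * PowerSeries.mk (risingCoeff θ)) := by
    intro g n hn
    rw [PowerSeries.coeff_mul, PowerSeries.coeff_mul]
    refine sum_congr rfl fun x hx => ?_
    rw [coeff_prod_expMonomial θ (by have := mem_antidiagonal.1 hx; lia), PowerSeries.coeff_mk]
  rw [hcoeff _ _ (Nat.sub_le _ _), risingCoeff]
  field_simp

lemma prod_fin_eq_prod_Icc (p : ℕ) (f : ℕ → ℝ) :
    ∏ j : Fin p, f ((j : ℕ) + 1) = ∏ i ∈ Icc 1 p, f i := by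
  rw [← prod_range fun j => f (j + 1), range_eq_Ico, prod_Ico_add' f 0 p 1, zero_add,
    Ico_add_one_right_eq_Icc]

/-- Theorem 1.1: for an Ewens(θ) random permutation, the vector of numbers of cycles of
lengths `1, …, p` converges in distribution to independent Poisson variables with
parameters `θ/p'`. -/
theorem cycle_counts_to_poisson (θ : ℝ) (hθ : 0 < θ) (p : ℕ) (hp : 0 < p)
    (k : Fin p → ℕ) :
    Filter.Tendsto
      (fun N => ewensP θ N {σ | ∀ j : Fin p, cyclesOfLength ((j : ℕ) + 1) σ = k j})
      Filter.atTop
      (nhds (∏ j : Fin p,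
        Real.exp (-(θ / ((j : ℕ) + 1))) * (θ / ((j : ℕ) + 1)) ^ (k j)
          / (Nat.factorial (k j) : ℝ))) := by
  let K : ℕ → ℕ := fun i => if h : i - 1 < p then k ⟨i - 1, h⟩ else 0
  have hK : ∀ j : Fin p, K ((j : ℕ) + 1) = k j := fun j => by simp [K]
  have hset : ∀ N, {σ : Equiv.Perm (Fin N) | ∀ j : Fin p, cyclesOfLength ((j : ℕ) + 1) σ = k j}
      = {σ | ∀ i ∈ Icc 1 p, cyclesOfLength i σ = K i} := fun N => by
    ext σ
    refine ⟨fun h i hi => ?_, fun h j => ?_⟩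
    · obtain ⟨hi₁, hip⟩ := mem_Icc.1 hi
      obtain ⟨j, rfl⟩ := Nat.exists_eq_add_of_le' hi₁
      exact (h ⟨j, hip⟩).trans (hK ⟨j, hip⟩).symm
    · rw [← hK j]
      exact h _ (mem_Icc.2 ⟨by lia, j.isLt⟩)
  have hlim : ∏ j : Fin p, Real.exp (-(θ / ((j : ℕ) + 1))) * (θ / ((j : ℕ) + 1)) ^ (k j)
        / (Nat.factorial (k j) : ℝ)
      = (∏ i ∈ Icc 1 p, cycleWeight θ i (K i))
        * ((∏ i ∈ Icc 1 p, Real.exp (-(θ / i))) * 1) := by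
    rw [mul_one, ← prod_mul_distrib, ← prod_fin_eq_prod_Icc]
    refine prod_congr rfl fun j _ => ?_
    rw [hK, cycleWeight]
    push_cast
    ring
  rw [hlim]
  set m := ∑ i ∈ Icc 1 p, i * K i
  have hmain := (tendsto_coeff_prod_expMonomial_neg hθ (Icc 1 p)
    fun i hi => (mem_Icc.1 hi).1).comp (Filter.tendsto_sub_atTop_nat m)
  have hratio := tendsto_sub_div (risingCoeff θ) (risingCoeff_pos hθ)
    (tendsto_risingCoeff_ratio hθ) m
  refine ((hmain.mul hratio).const_mul _).congr' ?_
  filter_upwards [Filter.eventually_ge_atTop p, Filter.eventually_ge_atTop m] with N hpN hmN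
  rw [hset, ewensP_cyclesOfLength_eq θ hpN K hmN, Function.comp_apply,
    div_mul_div_cancel₀ (risingCoeff_pos hθ _).ne']

end
end
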